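/- Let l, m, n₁, n₂ be positive integers with n₁ ≤ min(l,m) and n₂ ≤ m, let g be an l×m complex matrix of rank n₁ and x an m×m Hermitian matrix of rank n₂, set r = min(n₁,n₂) and d = |n₁−n₂|. Let s ∈ ℂ^r with Re(s_j − s_{j+1}) ≥ 1 for j = 1,…,r (convention s_{r+1} = −1) and L ∈ {0,1}^r. Define s̃ ∈ ℂ^{r+d} by s̃_j = s_j + d for 1 ≤ j ≤ r and s̃_{r+i} = d − i for 1 ≤ i ≤ d, and L̃ ∈ {0,1}^{r+d} by L̃_j = (L_j + d) mod 2 for 1 ≤ j ≤ r and L̃_{r+i} = (d−i) mod 2 for 1 ≤ i ≤ d. Then: if n₁ ≤ n₂, ∫_{U(m)} Φ_{l,r}(s, L; g k x k* g*) dk = C_{m,r+d}(s̃) · Ψ(s; g) · Φ_{m,n₂}(s̃, L̃; x); and if n₂ ≤ n₁, ∫_{U(m)} Φ_{l,r}(s, L; g k x k* g*) dk = C_{m,r+d}(s̃) · Ψ(s̃; g) · Φ_{m,n₂}(s, L; x). -/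

import Mathlib

open MeasureTheory Matrix Finset Filter

noncomputable section

namespace RMT

instance matMS (l m : ℕ) : MeasurableSpace (Matrix (Fin l) (Fin m) ℂ) :=
  inferInstanceAs (MeasurableSpace (Fin l → Fin m → ℂ))

/-- The real part of the determinant of the leading principal `j × j` submatrix. -/
def pminor {l : ℕ} (y : Matrix (Fin l) (Fin l) ℂ) (j : ℕ) : ℝ :=
  (Matrix.det (Matrix.of fun p q : Fin (min j l) =>
    y (Fin.castLE (min_le_right j l) p) (Fin.castLE (min_le_right j l) q))).re

/-- `s_{j+1}` with the convention `s_{n+1} = -1` (0-based index `j`). -/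
def sNext (n : ℕ) (s : ℕ → ℂ) (j : ℕ) : ℂ := if j + 1 < n then s (j + 1) else -1

/-- `L_{j+1}` with the convention `L_{n+1} = -1` (0-based index `j`). -/
def LNext (n : ℕ) (L : ℕ → ℤ) (j : ℕ) : ℤ := if j + 1 < n then L (j + 1) else -1

/-- The integrand of the spherical function `N_{l,n}(s,L;·)`. -/
def sphProd (n : ℕ) (s : ℕ → ℂ) (L : ℕ → ℤ) {l : ℕ} (y : Matrix (Fin l) (Fin l) ℂ) : ℂ :=
  ∏ j ∈ Finset.range n,
    if pminor y (j + 1) = 0 then 0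
    else ((Real.sign (pminor y (j + 1)) : ℂ) ^ (L j - LNext n L j - 1)) *
      (((|pminor y (j + 1)| : ℝ) : ℂ) ^ (s j - sNext n s j - 1))

/-- The integrand of the normalization constant `C_{l,n}(s)`. -/
def absProd (n : ℕ) (s : ℕ → ℂ) {l : ℕ} (y : Matrix (Fin l) (Fin l) ℂ) : ℂ :=
  ∏ j ∈ Finset.range n,
    if pminor y (j + 1) = 0 then 0
    else (((|pminor y (j + 1)| : ℝ) : ℂ) ^ (s j - sNext n s j - 1))

/-- `μ` is the normalized Haar probability measure of `U(l)`, viewed as a measure on the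
space of `l × l` complex matrices: it is a probability measure, it is carried by the
unitary group, and it is invariant under left translation by every unitary matrix.
(These properties determine `μ` uniquely.) -/
def IsHaarUnitary (l : ℕ) (μ : Measure (Matrix (Fin l) (Fin l) ℂ)) : Prop :=
  IsProbabilityMeasure μ ∧ μ {A | A ∈ Matrix.unitaryGroup (Fin l) ℂ}ᶜ = 0 ∧
    ∀ U ∈ Matrix.unitaryGroup (Fin l) ℂ, μ.map (fun A => U * A) = μ

/-- `N_{l,n}(s, L; x)`. -/
def Nsph (l n : ℕ) (μ : Measure (Matrix (Fin l) (Fin l) ℂ)) (s : ℕ → ℂ) (L : ℕ → ℤ)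
    (x : Matrix (Fin l) (Fin l) ℂ) : ℂ :=
  ∫ k, sphProd n s L (k * x * kᴴ) ∂μ

/-- The l×l diagonal matrix with `n` ones followed by zeros. -/
def projMat (l n : ℕ) : Matrix (Fin l) (Fin l) ℂ :=
  Matrix.diagonal fun i => if (i : ℕ) < n then 1 else 0

/-- The normalization `C_{l,n}(s)`. -/
def Csph (l n : ℕ) (μ : Measure (Matrix (Fin l) (Fin l) ℂ)) (s : ℕ → ℂ) : ℂ :=
  ∫ k, absProd n s (k * projMat l n * kᴴ) ∂μ

/-- The spherical function `Φ_{l,n}(s,L;x) = N_{l,n}(s,L;x)/C_{l,n}(s)`. -/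
def Phi (l n : ℕ) (μ : Measure (Matrix (Fin l) (Fin l) ℂ)) (s : ℕ → ℂ) (L : ℕ → ℤ)
    (x : Matrix (Fin l) (Fin l) ℂ) : ℂ :=
  Nsph l n μ s L x / Csph l n μ s

/-- `L^{(n)} = ((n-1) mod 2, (n-2) mod 2, …, 1, 0)`. -/
def Lstd (n : ℕ) : ℕ → ℤ := fun j => ((n - 1 - j : ℕ) : ℤ) % 2

/-- The spherical function `Ψ(s; g) = Φ_{l,n}(s, L^{(n)}; g g*)` for `g` of rank `n`. -/
def Psi (l m n : ℕ) (μ : Measure (Matrix (Fin l) (Fin l) ℂ)) (s : ℕ → ℂ)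
    (g : Matrix (Fin l) (Fin m) ℂ) : ℂ :=
  Phi l n μ s (Lstd n) (g * gᴴ)

/-- The Vandermonde determinant `Δ_n(a) = ∏_{c>d} (a_c - a_d)` (complex version). -/
def VdmC (n : ℕ) (a : ℕ → ℂ) : ℂ := ∏ c ∈ Finset.range n, ∏ d ∈ Finset.range c, (a c - a d)

/-- The Vandermonde determinant `Δ_n(a) = ∏_{c>d} (a_c - a_d)` (real version). -/
def VdmR (n : ℕ) (a : ℕ → ℝ) : ℝ := ∏ c ∈ Finset.range n, ∏ d ∈ Finset.range c, (a c - a d)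

end RMT

namespace RMT

/-- `s̃ = (s + d·1_r, s^{(d)})` where `r = min n₁ n₂`, `d = |n₁ - n₂|`. -/
def sTilde (n₁ n₂ : ℕ) (s : ℕ → ℂ) : ℕ → ℂ := fun j =>
  if j < min n₁ n₂ then s j + ((max n₁ n₂ - min n₁ n₂ : ℕ) : ℂ)
  else (((max n₁ n₂ : ℤ) - 1 - (j : ℤ) : ℤ) : ℂ)

/-- `L̃ = ((L + d·1_r) mod 2, L^{(d)})` where `r = min n₁ n₂`, `d = |n₁ - n₂|`. -/
def LTilde (n₁ n₂ : ℕ) (L : ℕ → ℤ) : ℕ → ℤ := fun j =>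
  if j < min n₁ n₂ then (L j + ((max n₁ n₂ - min n₁ n₂ : ℕ) : ℤ)) % 2
  else ((max n₁ n₂ : ℤ) - 1 - (j : ℤ)) % 2

def Ff (ε : ℤ) (σ : ℂ) (p : ℝ) : ℂ :=
  if p = 0 then 0 else ((Real.sign p : ℂ) ^ ε) * (((|p| : ℝ) : ℂ) ^ σ)

lemma Ff_mul (ε : ℤ) (σ : ℂ) {c : ℝ} (hc : 0 ≤ c) (p : ℝ) :
    Ff ε σ (c * p) = Ff 0 σ c * Ff ε σ p := by
  unfold Ff
  rcases hc.eq_or_lt with rfl | hc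
  · simp
  by_cases hp : p = 0
  · simp [hp]
  have h1 : Real.sign (c * p) = Real.sign p := by
    rcases lt_or_gt_of_ne hp with h | h
    · rw [Real.sign_of_neg h, Real.sign_of_neg (mul_neg_of_pos_of_neg hc h)]
    · rw [Real.sign_of_pos h, Real.sign_of_pos (mul_pos hc h)]
  rw [if_neg (mul_ne_zero hc.ne' hp), if_neg hc.ne', if_neg hp, h1, abs_mul, Complex.ofReal_mul,
    Complex.mul_cpow_ofReal_nonneg (abs_nonneg _) (abs_nonneg _)]
  simp only [zpow_zero, one_mul]
  ring

lemma Ff_zero_prod {ι : Type*} (t : Finset ι) (σ : ι → ℂ) {c : ℝ} (ht : t.Nonempty) :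
    ∏ j ∈ t, Ff 0 (σ j) c = Ff 0 (∑ j ∈ t, σ j) c := by
  unfold Ff
  by_cases hc : c = 0
  · obtain ⟨i, hi⟩ := ht
    simp only [hc, if_true]
    exact Finset.prod_eq_zero hi rfl
  · simp only [hc, if_false, zpow_zero, one_mul]
    have : ((|c| : ℝ) : ℂ) ≠ 0 := by simpa using hc
    classical
    induction t using Finset.induction_on with
    | empty => simp
    | insert a t ha ih =>
      rw [Finset.prod_insert ha, Finset.sum_insert ha, Complex.cpow_add _ _ this]
      by_cases h : t.Nonempty
      · rw [ih h]
      · simp [Finset.not_nonempty_iff_eq_empty.mp h]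

lemma Ff_one (σ : ℂ) : Ff 0 σ 1 = 1 := by simp [Ff]

def sP (r : ℕ) (ε : ℕ → ℤ) (σ : ℕ → ℂ) {l : ℕ} (y : Matrix (Fin l) (Fin l) ℂ) : ℂ :=
  ∏ j ∈ Finset.range r, Ff (ε j) (σ j) (pminor y (j + 1))

lemma sphProd_eq (n : ℕ) (s : ℕ → ℂ) (L : ℕ → ℤ) {l : ℕ} (y : Matrix (Fin l) (Fin l) ℂ) :
    sphProd n s L y = sP n (fun j => L j - LNext n L j - 1) (fun j => s j - sNext n s j - 1) y :=
  rfl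

lemma absProd_eq (n : ℕ) (s : ℕ → ℂ) {l : ℕ} (y : Matrix (Fin l) (Fin l) ℂ) :
    absProd n s y = sP n 0 (fun j => s j - sNext n s j - 1) y := by
  simp [absProd, sP, Ff]

lemma pminor_eq {l : ℕ} (y : Matrix (Fin l) (Fin l) ℂ) {j : ℕ} (h : j ≤ l) :
    pminor y j = (det (y.submatrix (Fin.castLE h) (Fin.castLE h))).re := by
  have key : ∀ (r : ℕ) (hr : r = j) (hl : r ≤ l),
      (Matrix.det (Matrix.of fun p q : Fin r => y (Fin.castLE hl p) (Fin.castLE hl q))).re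
        = (det (y.submatrix (Fin.castLE h) (Fin.castLE h))).re := by
    intro r hr hl
    subst hr
    rfl
  exact key _ (min_eq_left h) _

lemma qr {a m : ℕ} (A : Matrix (Fin a) (Fin m) ℂ) :
    ∃ (T : Matrix (Fin a) (Fin m) ℂ) (q : Matrix (Fin m) (Fin m) ℂ),
      q ∈ Matrix.unitaryGroup (Fin m) ℂ ∧ A = T * q ∧ ∀ i j, i.val < j.val → T i j = 0 := by
  let f : Fin m → EuclideanSpace ℂ (Fin m) := fun i =>
    if h : i.val < a then WithLp.toLp 2 (A ⟨i, h⟩) else 0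
  have hcard : Module.finrank ℂ (EuclideanSpace ℂ (Fin m)) = Fintype.card (Fin m) := by simp
  let b := InnerProductSpace.gramSchmidtOrthonormalBasis hcard f
  let q : Matrix (Fin m) (Fin m) ℂ := Matrix.of fun i j => b i j
  have hq : q * qᴴ = 1 := by
    ext i j
    have := (orthonormal_iff_ite.mp b.orthonormal) j i
    rw [Matrix.mul_apply, Matrix.one_apply]
    simp only [PiLp.inner_apply, RCLike.inner_apply] at this
    simp only [conjTranspose_apply, q, of_apply]
    rw [show (∑ x, (b i).ofLp x * star ((b j).ofLp x)) = if j = i then 1 else 0 from this]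
    simp [eq_comm]
  refine ⟨A * qᴴ, q, ?_, ?_, ?_⟩
  · exact Matrix.mem_unitaryGroup_iff.mpr hq
  · rw [Matrix.mul_assoc, mul_eq_one_comm.mp hq, Matrix.mul_one]
  · intro i j hij
    have hi : i.val < m := hij.trans j.2
    have := InnerProductSpace.gramSchmidtOrthonormalBasis_inv_triangular hcard f
      (i := ⟨i, hi⟩) (j := j) hij
    simp only [PiLp.inner_apply, RCLike.inner_apply, f, i.2, dif_pos] at this
    rw [Matrix.mul_apply]
    exact this

lemma tri_sub {a m : ℕ} (T : Matrix (Fin a) (Fin m) ℂ) (hT : ∀ i j, i.val < j.val → T i j = 0)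
    (y : Matrix (Fin m) (Fin m) ℂ) {j : ℕ} (ha : j ≤ a) (hm : j ≤ m) :
    (T * y * Tᴴ).submatrix (Fin.castLE ha) (Fin.castLE ha) =
      T.submatrix (Fin.castLE ha) (Fin.castLE hm) *
        y.submatrix (Fin.castLE hm) (Fin.castLE hm) *
        (T.submatrix (Fin.castLE ha) (Fin.castLE hm))ᴴ := by
  let E : Matrix (Fin j) (Fin m) ℂ := (1 : Matrix (Fin m) (Fin m) ℂ).submatrix (Fin.castLE hm) id
  have h1 : T.submatrix (Fin.castLE ha) id = T.submatrix (Fin.castLE ha) (Fin.castLE hm) * E := by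
    ext p u
    simp only [Matrix.mul_apply, E, submatrix_apply, id, Matrix.one_apply]
    by_cases hu : u.val < j
    · rw [Finset.sum_eq_single (⟨u, hu⟩ : Fin j)]
      · simp
      · intro v _ hv
        rw [if_neg, mul_zero]
        intro h
        apply hv
        ext
        simp [← h]
      · simp
    · rw [hT _ _ (by simpa using p.2.trans_le (not_lt.mp hu)), Finset.sum_eq_zero]
      intro v _
      rw [if_neg, mul_zero]
      intro h
      apply hu
      rw [← h]
      exact v.2
  have h2 : y.submatrix (Fin.castLE hm) (Fin.castLE hm) = E * y * Eᴴ := by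
    ext p u
    simp [Matrix.mul_apply, E, Matrix.one_apply]
  have h3 : (T * y * Tᴴ).submatrix (Fin.castLE ha) (Fin.castLE ha) =
      (T.submatrix (Fin.castLE ha) id) * y * (T.submatrix (Fin.castLE ha) id)ᴴ := by
    ext p u
    simp [Matrix.mul_apply]
  rw [h3, h1, h2, Matrix.conjTranspose_mul]
  simp only [Matrix.mul_assoc]

lemma pminor_tri {a m : ℕ} (T : Matrix (Fin a) (Fin m) ℂ) (hT : ∀ i j, i.val < j.val → T i j = 0)
    (y : Matrix (Fin m) (Fin m) ℂ) {j : ℕ} (ha : j ≤ a) (hm : j ≤ m) :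
    pminor (T * y * Tᴴ) j = pminor (T * Tᴴ) j * pminor y j ∧ 0 ≤ pminor (T * Tᴴ) j := by
  set B := T.submatrix (Fin.castLE ha) (Fin.castLE hm) with hB
  have key : ∀ y : Matrix (Fin m) (Fin m) ℂ, pminor (T * y * Tᴴ) j =
      Complex.normSq B.det * pminor y j := by
    intro y
    rw [pminor_eq _ ha, pminor_eq _ hm, tri_sub T hT y ha hm, det_mul, det_mul, det_conjTranspose,
      ← hB, mul_right_comm]
    have : B.det * star B.det = (Complex.normSq B.det : ℂ) := by
      simpa using Complex.mul_conj B.det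
    rw [this, Complex.re_ofReal_mul]
  have k1 := key 1
  have hone : pminor (1 : Matrix (Fin m) (Fin m) ℂ) j = 1 := by
    rw [pminor_eq _ hm, Matrix.submatrix_one _ (Fin.castLE_injective hm)]
    simp
  rw [Matrix.mul_one, hone, mul_one] at k1
  rw [k1]
  exact ⟨key y, Complex.normSq_nonneg _⟩

lemma sP_tri {a m r : ℕ} (ε : ℕ → ℤ) (σ : ℕ → ℂ) (T : Matrix (Fin a) (Fin m) ℂ)
    (hT : ∀ i j, i.val < j.val → T i j = 0)
    (y : Matrix (Fin m) (Fin m) ℂ) (ha : r ≤ a) (hm : r ≤ m) :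
    sP r ε σ (T * y * Tᴴ) = sP r 0 σ (T * Tᴴ) * sP r ε σ y := by
  unfold sP
  rw [← Finset.prod_mul_distrib]
  refine Finset.prod_congr rfl fun j hj => ?_
  have hj' := Finset.mem_range.mp hj
  obtain ⟨h1, h2⟩ := pminor_tri T hT y (j := j + 1) (by omega) (by omega)
  rw [h1, Ff_mul _ _ h2]
  rfl

def MM {α : Type*} [MeasurableSpace α] {a b : ℕ} (f : α → Matrix (Fin a) (Fin b) ℂ) : Prop :=
  ∀ i j, Measurable fun t => f t i j

lemma MM.const {α : Type*} [MeasurableSpace α] {a b : ℕ} (A : Matrix (Fin a) (Fin b) ℂ) :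
    MM (fun _ : α => A) := fun _ _ => measurable_const

lemma MM.mul {α : Type*} [MeasurableSpace α] {a b c : ℕ} {f : α → Matrix (Fin a) (Fin b) ℂ}
    {g : α → Matrix (Fin b) (Fin c) ℂ} (hf : MM f) (hg : MM g) : MM (fun t => f t * g t) := by
  intro i j
  simp only [Matrix.mul_apply]
  exact Finset.measurable_sum _ fun u _ => (hf i u).mul (hg u j)

lemma MM.ct {α : Type*} [MeasurableSpace α] {a b : ℕ} {f : α → Matrix (Fin a) (Fin b) ℂ}
    (hf : MM f) : MM (fun t => (f t)ᴴ) := by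
  intro i j
  simp only [Matrix.conjTranspose_apply]
  exact (Complex.continuous_conj.measurable).comp (hf j i)

lemma MM.of_meas {α : Type*} [MeasurableSpace α] {a b : ℕ} {f : α → Matrix (Fin a) (Fin b) ℂ}
    (hf : Measurable f) : MM f := fun i j =>
  (measurable_pi_apply j).comp ((measurable_pi_apply (X := fun _ : Fin a => Fin b → ℂ) i).comp hf)

lemma MM.meas {α : Type*} [MeasurableSpace α] {a b : ℕ} {f : α → Matrix (Fin a) (Fin b) ℂ}
    (hf : MM f) : Measurable f :=
  measurable_pi_lambda (X := fun _ : Fin a => Fin b → ℂ) _ fun i => measurable_pi_lambda _ fun j => hf i j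

lemma meas_Ff (ε : ℤ) (σ : ℂ) : Measurable (Ff ε σ) := by
  unfold Ff
  have hs : Measurable Real.sign := by
    unfold Real.sign
    exact Measurable.ite measurableSet_Iio measurable_const
      (Measurable.ite measurableSet_Ioi measurable_const measurable_const)
  refine Measurable.ite (measurableSet_singleton 0) measurable_const ?_
  refine Measurable.mul ?_ ?_
  · have : Measurable fun p : ℝ => ((Real.sign p) ^ ε : ℝ) := by
      cases ε with
      | ofNat n => exact (hs.pow_const n)
      | negSucc n =>
        simp only [zpow_negSucc]
        exact (hs.pow_const (n + 1)).inv
    have h2 := Complex.measurable_ofReal.comp this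
    simp only [Function.comp_def, Complex.ofReal_zpow] at h2
    exact h2
  · exact (Complex.measurable_ofReal.comp (measurable_norm)).pow_const σ

lemma MM.pminor {α : Type*} [MeasurableSpace α] {l : ℕ} {f : α → Matrix (Fin l) (Fin l) ℂ}
    (hf : MM f) (j : ℕ) : Measurable fun t => RMT.pminor (f t) j := by
  unfold RMT.pminor
  refine Complex.measurable_re.comp ?_
  simp only [Matrix.det_apply, Matrix.of_apply]
  refine Finset.measurable_sum _ fun π _ => ?_
  refine Measurable.const_smul ?_ _
  exact Finset.measurable_prod _ fun u _ => hf _ _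

lemma MM.sP {α : Type*} [MeasurableSpace α] {l : ℕ} {f : α → Matrix (Fin l) (Fin l) ℂ}
    (hf : MM f) (r : ℕ) (ε : ℕ → ℤ) (σ : ℕ → ℂ) : Measurable fun t => RMT.sP r ε σ (f t) := by
  unfold RMT.sP
  exact Finset.measurable_prod _ fun u _ => (meas_Ff _ _).comp (hf.pminor _)

lemma Ff_norm_le (ε : ℤ) {σ : ℂ} (hσ : 0 ≤ σ.re) {p B : ℝ} (hp : |p| ≤ B) (hB : 1 ≤ B) :
    ‖Ff ε σ p‖ ≤ B ^ σ.re := by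
  unfold Ff
  split_ifs with h
  · simp only [norm_zero]; positivity
  · have h1 : ‖(Real.sign p : ℂ) ^ ε‖ = 1 := by
      rw [norm_zpow]
      rcases lt_or_gt_of_ne h with h | h
      · simp [Real.sign_of_neg h]
      · simp [Real.sign_of_pos h]
    rw [norm_mul, h1, one_mul, Complex.norm_cpow_eq_rpow_re_of_pos (abs_pos.mpr h)]
    exact Real.rpow_le_rpow (abs_nonneg _) hp hσ

lemma pminor_le {l : ℕ} (y : Matrix (Fin l) (Fin l) ℂ) {X : ℝ} (hX : 0 ≤ X)
    (hy : ∀ i j, ‖y i j‖ ≤ X) (j : ℕ) : |pminor y j| ≤ (l.factorial : ℝ) * (1 + X) ^ l := by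
  unfold pminor
  refine (Complex.abs_re_le_norm _).trans ?_
  have := Matrix.det_le (abv := NormedField.toAbsoluteValue ℂ) (x := X)
    (A := Matrix.of fun p q : Fin (min j l) =>
      y (Fin.castLE (min_le_right j l) p) (Fin.castLE (min_le_right j l) q))
    (fun i j => hy _ _)
  refine this.trans ?_
  rw [nsmul_eq_mul, Fintype.card_fin]
  have h1 : (((min j l).factorial : ℕ) : ℝ) ≤ (l.factorial : ℝ) := by
    exact_mod_cast Nat.factorial_le (min_le_right j l)
  have h2 : X ^ (min j l) ≤ (1 + X) ^ l :=
    (pow_le_pow_left₀ hX (by linarith) _).trans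
      (pow_le_pow_right₀ (by linarith) (min_le_right j l))
  exact mul_le_mul h1 h2 (by positivity) (by positivity)

lemma sP_bound (l r : ℕ) (σ : ℕ → ℂ) (hσ : ∀ j < r, 0 ≤ (σ j).re) :
    ∃ K N : ℝ, 0 ≤ K ∧ 0 ≤ N ∧ ∀ (ε : ℕ → ℤ) (y : Matrix (Fin l) (Fin l) ℂ) (X : ℝ), 0 ≤ X →
      (∀ i j, ‖y i j‖ ≤ X) → ‖sP r ε σ y‖ ≤ K * (1 + X) ^ N := by
  set W := ∑ j ∈ range r, (σ j).re with hW
  have hW0 : 0 ≤ W := Finset.sum_nonneg fun j hj => hσ j (Finset.mem_range.mp hj)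
  refine ⟨(l.factorial : ℝ) ^ W, l * W, by positivity, by positivity, ?_⟩
  intro ε y X hX hy
  have hB : (1 : ℝ) ≤ (l.factorial : ℝ) * (1 + X) ^ l := by
    have h1 : (1 : ℝ) ≤ (l.factorial : ℝ) := by exact_mod_cast Nat.one_le_iff_ne_zero.mpr (Nat.factorial_ne_zero l)
    have h2 : (1 : ℝ) ≤ (1 + X) ^ l := one_le_pow₀ (by linarith)
    nlinarith
  unfold sP
  rw [norm_prod]
  calc ∏ j ∈ range r, ‖Ff (ε j) (σ j) (pminor y (j + 1))‖
      ≤ ∏ j ∈ range r, ((l.factorial : ℝ) * (1 + X) ^ l) ^ (σ j).re := by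
        refine Finset.prod_le_prod (fun _ _ => norm_nonneg _) fun j hj => ?_
        exact Ff_norm_le _ (hσ j (Finset.mem_range.mp hj)) (pminor_le y hX hy _) hB
    _ = ((l.factorial : ℝ) * (1 + X) ^ l) ^ W := by
        rw [hW, Real.rpow_sum_of_pos (by linarith)]
    _ = _ := by
        rw [Real.mul_rpow (by positivity) (by positivity), ← Real.rpow_natCast, ← Real.rpow_mul (by linarith)]

lemma mul_bd {a b c : ℕ} {A : Matrix (Fin a) (Fin b) ℂ} {B : Matrix (Fin b) (Fin c) ℂ} {X Y : ℝ}
    (hX : 0 ≤ X)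
    (hA : ∀ i j, ‖A i j‖ ≤ X) (hB : ∀ i j, ‖B i j‖ ≤ Y) (i : Fin a) (j : Fin c) :
    ‖(A * B) i j‖ ≤ b * (X * Y) := by
  rw [Matrix.mul_apply]
  refine (norm_sum_le _ _).trans ?_
  refine (Finset.sum_le_sum (g := fun _ => X * Y) fun u _ => ?_).trans (by simp)
  rw [norm_mul]
  exact mul_le_mul (hA _ _) (hB _ _) (norm_nonneg _) hX

lemma ct_bd {a b : ℕ} {A : Matrix (Fin a) (Fin b) ℂ} {X : ℝ}
    (hA : ∀ i j, ‖A i j‖ ≤ X) (i : Fin b) (j : Fin a) :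
    ‖Aᴴ i j‖ ≤ X := by
  rw [Matrix.conjTranspose_apply, norm_star]; exact hA _ _

lemma mat_bd {a b : ℕ} (A : Matrix (Fin a) (Fin b) ℂ) :
    ∃ X : ℝ, 0 ≤ X ∧ ∀ i j, ‖A i j‖ ≤ X := by
  refine ⟨∑ i, ∑ j, ‖A i j‖, by positivity, fun i j => ?_⟩
  calc ‖A i j‖ ≤ ∑ j, ‖A i j‖ := Finset.single_le_sum (f := fun j => ‖A i j‖)
        (fun _ _ => norm_nonneg _) (Finset.mem_univ j)
    _ ≤ _ := Finset.single_le_sum (f := fun i => ∑ j, ‖A i j‖)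
        (fun _ _ => by positivity) (Finset.mem_univ i)

lemma IsHaarUnitary.ae {m : ℕ} {μ : Measure (Matrix (Fin m) (Fin m) ℂ)} (h : IsHaarUnitary m μ) :
    ∀ᵐ k ∂μ, k ∈ Matrix.unitaryGroup (Fin m) ℂ := h.2.1

lemma IsHaarUnitary.mp {m : ℕ} {μ : Measure (Matrix (Fin m) (Fin m) ℂ)} (h : IsHaarUnitary m μ)
    {U : Matrix (Fin m) (Fin m) ℂ} (hU : U ∈ Matrix.unitaryGroup (Fin m) ℂ) :
    MeasurePreserving (fun A => U * A) μ μ :=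
  ⟨((MM.const U).mul (MM.of_meas measurable_id)).meas, h.2.2 U hU⟩

lemma haar_integral {m : ℕ} {μ : Measure (Matrix (Fin m) (Fin m) ℂ)} (h : IsHaarUnitary m μ)
    {U : Matrix (Fin m) (Fin m) ℂ} (hU : U ∈ Matrix.unitaryGroup (Fin m) ℂ)
    {F : Matrix (Fin m) (Fin m) ℂ → ℂ} (hF : Measurable F) :
    ∫ k, F (U * k) ∂μ = ∫ k, F k ∂μ := by
  have h1 := h.mp hU
  conv_rhs => rw [← h1.map_eq]
  rw [integral_map h1.measurable.aemeasurable hF.aestronglyMeasurable]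

lemma MM_id {a b : ℕ} : MM (fun k : Matrix (Fin a) (Fin b) ℂ => k) := MM.of_meas measurable_id

lemma haar_factor {a m r : ℕ} {μ : Measure (Matrix (Fin m) (Fin m) ℂ)} (h : IsHaarUnitary m μ)
    (ε : ℕ → ℤ) (σ : ℕ → ℂ) (A : Matrix (Fin a) (Fin m) ℂ) (x : Matrix (Fin m) (Fin m) ℂ)
    (ha : r ≤ a) (hm : r ≤ m) :
    ∫ k, sP r ε σ (A * (k * x * kᴴ) * Aᴴ) ∂μ =
      sP r 0 σ (A * Aᴴ) * ∫ k, sP r ε σ (k * x * kᴴ) ∂μ := by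
  obtain ⟨T, q, hq, rfl, hT⟩ := qr A
  have hqq : q * qᴴ = 1 := Matrix.mem_unitaryGroup_iff.mp hq
  have h1 : (T * q) * (T * q)ᴴ = T * Tᴴ := by
    rw [Matrix.conjTranspose_mul, Matrix.mul_assoc, ← Matrix.mul_assoc q, hqq, Matrix.one_mul]
  have h2 : ∀ k : Matrix (Fin m) (Fin m) ℂ, (T * q) * (k * x * kᴴ) * (T * q)ᴴ =
      T * ((q * k) * x * (q * k)ᴴ) * Tᴴ := by
    intro k
    simp only [Matrix.conjTranspose_mul, Matrix.mul_assoc]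
  simp_rw [h1, h2]
  rw [haar_integral h hq (F := fun k => sP r ε σ (T * (k * x * kᴴ) * Tᴴ))]
  · simp_rw [sP_tri ε σ T hT _ ha hm]
    rw [integral_const_mul]
  · exact (((MM.const T).mul ((MM_id.mul (MM.const x)).mul MM_id.ct)).mul (MM.const Tᴴ)).sP _ _ _

lemma unit_bd {m : ℕ} {k : Matrix (Fin m) (Fin m) ℂ} (hk : k ∈ Matrix.unitaryGroup (Fin m) ℂ) :
    ∀ i j, ‖k i j‖ ≤ 1 := fun i j => entry_norm_bound_of_unitary hk i j

lemma main_factor {l m r : ℕ} {μl : Measure (Matrix (Fin l) (Fin l) ℂ)} (hl : IsHaarUnitary l μl)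
    {μm : Measure (Matrix (Fin m) (Fin m) ℂ)} (hm : IsHaarUnitary m μm)
    (ε : ℕ → ℤ) (σ : ℕ → ℂ) (hσ : ∀ j < r, 0 ≤ (σ j).re)
    (g : Matrix (Fin l) (Fin m) ℂ) (x : Matrix (Fin m) (Fin m) ℂ)
    (hrl : r ≤ l) (hrm : r ≤ m) :
    ∫ k, ∫ h, sP r ε σ (h * (g * (k * x * kᴴ) * gᴴ) * hᴴ) ∂μl ∂μm =
      (∫ h, sP r 0 σ (h * (g * gᴴ) * hᴴ) ∂μl) * ∫ k, sP r ε σ (k * x * kᴴ) ∂μm := by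
  have := hl.1
  have := hm.1
  rw [integral_integral_swap]
  · rw [← integral_mul_const]
    refine integral_congr_ae (Eventually.of_forall fun h => ?_)
    have := haar_factor hm ε σ (h * g) x hrl hrm
    simp only [Matrix.conjTranspose_mul, Matrix.mul_assoc] at this ⊢
    exact this
  · obtain ⟨K, N, hK, hN, hb⟩ := sP_bound l r σ hσ
    obtain ⟨G, hG, hGb⟩ := mat_bd g
    obtain ⟨Y, hY, hYb⟩ := mat_bd x
    have hMM : MM (fun z : Matrix (Fin m) (Fin m) ℂ × Matrix (Fin l) (Fin l) ℂ =>
        z.2 * (g * (z.1 * x * z.1ᴴ) * gᴴ) * z.2ᴴ) := by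
      have m1 := MM.of_meas (measurable_fst (α := Matrix (Fin m) (Fin m) ℂ) (β := Matrix (Fin l) (Fin l) ℂ))
      have m2 := MM.of_meas (measurable_snd (α := Matrix (Fin m) (Fin m) ℂ) (β := Matrix (Fin l) (Fin l) ℂ))
      exact (m2.mul (((MM.const g).mul ((m1.mul (MM.const x)).mul m1.ct)).mul (MM.const gᴴ))).mul m2.ct
    have hbd : ∃ X : ℝ, 0 ≤ X ∧ ∀ (k : Matrix (Fin m) (Fin m) ℂ) (h : Matrix (Fin l) (Fin l) ℂ),
        (∀ i j, ‖k i j‖ ≤ 1) → (∀ i j, ‖h i j‖ ≤ 1) →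
        ∀ i j, ‖(h * (g * (k * x * kᴴ) * gᴴ) * hᴴ) i j‖ ≤ X := by
      refine ⟨_, ?_, fun k h hk hh => mul_bd ?_ (mul_bd ?_ hh (mul_bd ?_ (mul_bd ?_ hGb
        (mul_bd ?_ (mul_bd ?_ hk hYb) (ct_bd hk))) (ct_bd hGb))) (ct_bd hh)⟩ <;> positivity
    obtain ⟨X, hX, hXb⟩ := hbd
    refine Integrable.of_bound (C := K * (1 + X) ^ N) (hMM.sP r ε σ).aestronglyMeasurable ?_
    have e1 : ∀ᵐ z ∂(μm.prod μl), z.1 ∈ Matrix.unitaryGroup (Fin m) ℂ :=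
      Measure.quasiMeasurePreserving_fst.ae hm.ae
    have e2 : ∀ᵐ z ∂(μm.prod μl), z.2 ∈ Matrix.unitaryGroup (Fin l) ℂ :=
      Measure.quasiMeasurePreserving_snd.ae hl.ae
    filter_upwards [e1, e2] with z h1 h2
    exact hb _ _ X hX (hXb _ _ (unit_bd h1) (unit_bd h2))

def gdens (z : ℂ) : ℝ := Real.pi⁻¹ * Real.exp (-‖z‖ ^ 2)

lemma gdens_pos (z : ℂ) : 0 < gdens z := by unfold gdens; positivity

lemma gdens_cont : Continuous gdens := by unfold gdens; fun_prop

lemma gauss_integrable {b : ℝ} (hb : 0 < b) : Integrable fun z : ℂ => Real.exp (-b * ‖z‖ ^ 2) := by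
  have := GaussianFourier.integrable_cexp_neg_mul_sq_norm_add (V := ℂ) (b := b) (by simpa using hb) 0 0
  have h2 := this.norm
  refine h2.congr (Eventually.of_forall fun z => ?_)
  simp only [Complex.norm_exp]
  congr 1
  simp only [inner_zero_left, Complex.ofReal_zero, mul_zero, add_zero]
  rw [← Complex.ofReal_pow, ← Complex.ofReal_neg, ← Complex.ofReal_mul, Complex.ofReal_re]

lemma gdens_integrable : Integrable gdens := by
  unfold gdens
  refine Integrable.const_mul ?_ _
  simpa using gauss_integrable one_pos

lemma gdens_integral : ∫ z, gdens z = 1 := by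
  unfold gdens
  rw [integral_const_mul]
  have := GaussianFourier.integral_rexp_neg_mul_sq_norm (V := ℂ) (b := 1) one_pos
  simp only [neg_mul, one_mul, Complex.finrank_real_complex, div_one] at this
  rw [this]
  norm_num

def gam : Measure ℂ := volume.withDensity fun z => ENNReal.ofReal (gdens z)

instance : IsProbabilityMeasure gam := by
  refine ⟨?_⟩
  rw [gam, withDensity_apply _ MeasurableSet.univ, Measure.restrict_univ,
    ← ofReal_integral_eq_lintegral_ofReal gdens_integrable
      (Eventually.of_forall fun z => (gdens_pos z).le), gdens_integral]
  simp

def Gam (n : ℕ) : Measure (Fin n → ℂ) := Measure.pi fun _ => gam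

instance (n : ℕ) : IsProbabilityMeasure (Gam n) := by unfold Gam; infer_instance

lemma Gam_eq (n : ℕ) : Gam n =
    (volume : Measure (Fin n → ℂ)).withDensity fun z => ENNReal.ofReal (∏ i, gdens (z i)) := by
  unfold Gam
  refine Measure.pi_eq fun s hs => ?_
  have hS : MeasurableSet (Set.univ.pi s) := MeasurableSet.univ_pi hs
  rw [withDensity_apply _ hS, ← lintegral_indicator hS]
  have h1 : ∀ z : Fin n → ℂ, (Set.univ.pi s).indicator
      (fun z => ENNReal.ofReal (∏ i, gdens (z i))) z =
      ENNReal.ofReal (∏ i, (s i).indicator gdens (z i)) := by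
    intro z
    by_cases hz : z ∈ Set.univ.pi s
    · rw [Set.indicator_of_mem hz]
      congr 1
      refine Finset.prod_congr rfl fun i _ => ?_
      rw [Set.indicator_of_mem (hz i trivial)]
    · rw [Set.indicator_of_notMem hz]
      simp only [Set.mem_pi, Set.mem_univ, true_implies, not_forall] at hz
      obtain ⟨i, hi⟩ := hz
      rw [Finset.prod_eq_zero (Finset.mem_univ i) (Set.indicator_of_notMem hi _)]
      simp
  have hi : ∀ i, Integrable ((s i).indicator gdens) := fun i => gdens_integrable.indicator (hs i)
  have h0 : ∀ i z, 0 ≤ (s i).indicator gdens z := fun i z =>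
    Set.indicator_nonneg (fun z _ => (gdens_pos z).le) z
  simp_rw [h1]
  rw [← ofReal_integral_eq_lintegral_ofReal]
  · rw [integral_fintype_prod_volume_eq_prod (fun i => (s i).indicator gdens),
      ENNReal.ofReal_prod_of_nonneg fun i _ => integral_nonneg (h0 i)]
    refine Finset.prod_congr rfl fun i _ => ?_
    rw [ofReal_integral_eq_lintegral_ofReal (hi i) (Eventually.of_forall (h0 i)), gam,
      withDensity_apply _ (hs i), ← lintegral_indicator (hs i)]
    refine lintegral_congr fun z => ?_
    by_cases hz : z ∈ s i <;> simp [hz]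
  · exact Integrable.fintype_prod hi
  · exact Eventually.of_forall fun z => Finset.prod_nonneg fun i _ => h0 i _

def nsq {n : ℕ} (z : Fin n → ℂ) : ℝ := ∑ i, ‖z i‖ ^ 2

lemma gprod_eq {n : ℕ} (z : Fin n → ℂ) :
    ∏ i, gdens (z i) = (Real.pi⁻¹) ^ n * Real.exp (-nsq z) := by
  unfold gdens nsq
  rw [Finset.prod_mul_distrib, ← Real.exp_sum]
  simp

lemma nsq_eq {n : ℕ} (z : Fin n → ℂ) : ((nsq z : ℝ) : ℂ) = z ⬝ᵥ star z := by
  unfold nsq dotProduct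
  push_cast
  refine Finset.sum_congr rfl fun i _ => ?_
  simp [Complex.mul_conj']

lemma nsq_vecMul {n : ℕ} {U : Matrix (Fin n) (Fin n) ℂ} (hU : U ∈ Matrix.unitaryGroup (Fin n) ℂ)
    (z : Fin n → ℂ) : nsq (z ᵥ* U) = nsq z := by
  have hUU : U * Uᴴ = 1 := Matrix.mem_unitaryGroup_iff.mp hU
  have : ((nsq (z ᵥ* U) : ℝ) : ℂ) = (nsq z : ℝ) := by
    rw [nsq_eq, nsq_eq, Matrix.star_vecMul, ← Matrix.dotProduct_mulVec, Matrix.mulVec_mulVec, hUU,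
      Matrix.one_mulVec]
  exact_mod_cast this

lemma vecMul_mp {n : ℕ} {U : Matrix (Fin n) (Fin n) ℂ} (hU : U ∈ Matrix.unitaryGroup (Fin n) ℂ) :
    MeasurePreserving (fun z : Fin n → ℂ => z ᵥ* U) volume volume ∧
    MeasurePreserving (fun z : Fin n → ℂ => z ᵥ* U) (Gam n) (Gam n) := by
  have hUU : U * Uᴴ = 1 := Matrix.mem_unitaryGroup_iff.mp hU
  let f : (Fin n → ℂ) →ₗ[ℝ] (Fin n → ℂ) := (Matrix.vecMulLinear U).restrictScalars ℝ
  let g : (Fin n → ℂ) →ₗ[ℝ] (Fin n → ℂ) := (Matrix.vecMulLinear Uᴴ).restrictScalars ℝ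
  have hfg : g ∘ₗ f = LinearMap.id := by
    refine LinearMap.ext fun z => ?_
    simp [f, g, Matrix.vecMul_vecMul, hUU]
  have hdet : LinearMap.det f ≠ 0 := by
    have := congrArg LinearMap.det hfg
    rw [LinearMap.det_comp, LinearMap.det_id] at this
    exact right_ne_zero_of_mul_eq_one this
  have hmap := Measure.map_linearMap_addHaar_eq_smul_addHaar (volume : Measure (Fin n → ℂ)) hdet
  set c := ENNReal.ofReal |(LinearMap.det f)⁻¹| with hc
  have hfm : Measurable f := f.continuous_of_finiteDimensional.measurable
  have hD : Measurable fun z : Fin n → ℂ => ENNReal.ofReal (∏ i, gdens (z i)) := by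
    refine ENNReal.measurable_ofReal.comp ?_
    exact Finset.measurable_prod _ fun i _ => gdens_cont.measurable.comp (measurable_pi_apply i)
  have hDf : ∀ z, (∏ i, gdens (f z i)) = ∏ i, gdens (z i) := by
    intro z
    rw [gprod_eq, gprod_eq]
    congr 3
    exact nsq_vecMul hU z
  have key : ∀ s, MeasurableSet s → (Gam n).map f s = c * Gam n s := by
    intro s hs
    rw [Measure.map_apply hfm hs, Gam_eq, withDensity_apply _ (hfm hs), withDensity_apply _ hs]
    have : ∫⁻ z in s, ENNReal.ofReal (∏ i, gdens (z i)) ∂(volume.map f) =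
        ∫⁻ z in f ⁻¹' s, ENNReal.ofReal (∏ i, gdens (f z i)) := by
      rw [setLIntegral_map hs hD hfm]
    simp_rw [hDf] at this
    rw [← this, hmap, Measure.restrict_smul, lintegral_smul_measure, smul_eq_mul]
  have hc1 : c = 1 := by
    have := key Set.univ MeasurableSet.univ
    rw [Measure.map_apply hfm MeasurableSet.univ, Set.preimage_univ, measure_univ, mul_one] at this
    exact this.symm
  constructor
  · refine ⟨hfm, ?_⟩
    rw [hc1, one_smul] at hmap
    exact hmap
  · refine ⟨hfm, ?_⟩
    ext s hs
    have := key s hs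
    rw [hc1, one_mul] at this
    exact this

lemma Gam_comp {n m : ℕ} (e : Fin n → Fin m) (he : Function.Injective e) :
    MeasurePreserving (fun (z : Fin m → ℂ) i => z (e i)) (Gam m) (Gam n) := by
  have hm : Measurable (fun (z : Fin m → ℂ) i => z (e i)) :=
    measurable_pi_lambda _ fun i => measurable_pi_apply _
  refine ⟨hm, ?_⟩
  have hI : ProbabilityTheory.iIndepFun (fun (i : Fin m) (z : Fin m → ℂ) => z i) (Gam m) := by
    have := ProbabilityTheory.iIndepFun_pi (μ := fun _ : Fin m => gam) (X := fun _ z => z)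
      (fun i => aemeasurable_id)
    exact this
  have h2 := hI.precomp he
  rw [ProbabilityTheory.iIndepFun_iff_map_fun_eq_pi_map
    (fun i => (measurable_pi_apply _).aemeasurable)] at h2
  refine h2.trans ?_
  unfold Gam
  congr 1
  funext i
  exact (measurePreserving_eval (fun _ : Fin m => gam) (e i)).map_eq

lemma gam_exp_integrable : Integrable (fun z : ℂ => Real.exp (‖z‖ ^ 2 / 2)) gam := by
  unfold gam
  rw [integrable_withDensity_iff_integrable_smul' (by
    exact (ENNReal.measurable_ofReal.comp gdens_cont.measurable)) (by simp)]
  have := (gauss_integrable (b := 1 / 2) (by norm_num)).const_mul Real.pi⁻¹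
  refine this.congr (Eventually.of_forall fun z => ?_)
  simp only [ENNReal.toReal_ofReal (gdens_pos z).le, smul_eq_mul]
  unfold gdens
  rw [mul_assoc, ← Real.exp_add]
  congr 2
  ring

def Mom (n : ℕ) (w : ℂ) : ℂ := ∫ z, Ff 0 w (nsq z) ∂(Gam n)

lemma Mom_ne_zero {n : ℕ} (hn : 1 ≤ n) {w : ℂ} (hw : 0 ≤ w.re) : Mom n w ≠ 0 := by
  have : NeZero n := ⟨by omega⟩
  unfold Mom
  rw [Gam_eq, integral_withDensity_eq_integral_toReal_smul (by
    refine ENNReal.measurable_ofReal.comp ?_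
    exact Finset.measurable_prod _ fun i _ => gdens_cont.measurable.comp (measurable_pi_apply i))
    (by simp)]
  let E := EuclideanSpace ℂ (Fin n)
  let e : (Fin n → ℂ) ≃L[ℝ] E := (PiLp.continuousLinearEquiv 2 ℝ (fun _ : Fin n => ℂ)).symm
  let ν : Measure E := Measure.map e volume
  have hν : ν.IsAddHaarMeasure := e.isAddHaarMeasure_map volume
  let φ : ℝ → ℂ := fun t => ((Real.pi⁻¹ ^ n * Real.exp (-t ^ 2) : ℝ) : ℂ) * Ff 0 w (t ^ 2)
  have hnorm : ∀ z : Fin n → ℂ, ‖e z‖ ^ 2 = nsq z := by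
    intro z
    rw [EuclideanSpace.norm_sq_eq]
    rfl
  have h1 : ∀ z : Fin n → ℂ, (ENNReal.ofReal (∏ i, gdens (z i))).toReal • Ff 0 w (nsq z) = φ ‖e z‖ := by
    intro z
    rw [ENNReal.toReal_ofReal (Finset.prod_nonneg fun i _ => (gdens_pos _).le), gprod_eq]
    simp only [φ, hnorm]
    rfl
  simp_rw [h1]
  have h2 : ∫ z, φ ‖e z‖ = ∫ x, φ ‖x‖ ∂ν := by
    exact (e.toHomeomorph.toMeasurableEquiv.measurableEmbedding.integral_map (μ := volume)
      (fun x : E => φ ‖x‖)).symm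
  have hdim : Module.finrank ℝ E = 2 * n := by
    rw [← e.toLinearEquiv.finrank_eq]
    rw [Module.finrank_pi_fintype]
    simp [Complex.finrank_real_complex, mul_comm]
  have hnt : Nontrivial E := inferInstance
  rw [h2, integral_fun_norm_addHaar ν φ, hdim]
  have h3 : ∫ y in Set.Ioi (0 : ℝ), y ^ (2 * n - 1) • φ y =
      (((Real.pi⁻¹ ^ n / 2 : ℝ)) : ℂ) * Complex.Gamma (n + w) := by
    rw [Complex.Gamma_eq_integral (by simp; positivity), Complex.GammaIntegral,
      ← integral_comp_rpow_Ioi_of_pos (g := fun x : ℝ => (((-x).exp : ℝ) : ℂ) * (x : ℂ) ^ ((n : ℂ) + w - 1))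
        (p := 2) (by norm_num), ← integral_const_mul]
    refine setIntegral_congr_fun measurableSet_Ioi fun y hy => ?_
    have hy : 0 < y := hy
    have hy2 : (0 : ℝ) < y ^ 2 := by positivity
    have e1 : y ^ (2 : ℝ) = y ^ 2 := by norm_cast
    have e2 : (2 : ℝ) - 1 = 1 := by norm_num
    simp only [e1, e2, Real.rpow_one, φ, Ff, hy2.ne', if_false, zpow_zero, one_mul, abs_of_pos hy2]
    have e3 : ((y ^ 2 : ℝ) : ℂ) ^ ((n : ℂ) + w - 1) = (y : ℂ) ^ (2 * (n - 1)) * ((y ^ 2 : ℝ) : ℂ) ^ w := by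
      rw [show (n : ℂ) + w - 1 = ((n - 1 : ℕ) : ℂ) + w by rw [Nat.cast_sub hn]; push_cast; ring,
        Complex.cpow_add _ _ (by exact_mod_cast hy2.ne'), Complex.cpow_natCast]
      push_cast
      rw [pow_mul]
    rw [e3]
    have e4 : 2 * n - 1 = 2 * (n - 1) + 1 := by omega
    rw [e4]
    simp only [Complex.real_smul]
    push_cast
    ring
  rw [h3]
  have hb : ν.real (Metric.ball 0 1) ≠ 0 := by
    rw [Measure.real, ENNReal.toReal_ne_zero]
    exact ⟨(Metric.measure_ball_pos ν _ one_pos).ne', measure_ball_lt_top.ne⟩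
  have hG : Complex.Gamma (n + w) ≠ 0 := Complex.Gamma_ne_zero_of_re_pos (by simp; positivity)
  have hpi : ((Real.pi⁻¹ ^ n / 2 : ℝ) : ℂ) ≠ 0 := by
    have : (0 : ℝ) < Real.pi⁻¹ ^ n / 2 := by positivity
    exact_mod_cast this.ne'
  rw [nsmul_eq_mul, Complex.real_smul]
  refine mul_ne_zero ?_ (mul_ne_zero ?_ (mul_ne_zero hpi hG))
  · have : 2 * n ≠ 0 := by omega
    exact_mod_cast this
  · exact_mod_cast hb

def GM (r n : ℕ) : Measure (Matrix (Fin r) (Fin n) ℂ) :=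
  (Measure.pi fun _ : Fin r => Gam n : Measure (Fin r → Fin n → ℂ))

instance (r n : ℕ) : IsProbabilityMeasure (GM r n) := by
  have : IsProbabilityMeasure (Measure.pi fun _ : Fin r => Gam n) := inferInstance
  exact this

def GG (r n : ℕ) (σ : ℕ → ℂ) : ℂ := ∫ Z, sP r 0 σ (Z * Zᴴ) ∂(GM r n)

lemma GM_mul {r n : ℕ} {U : Matrix (Fin n) (Fin n) ℂ} (hU : U ∈ Matrix.unitaryGroup (Fin n) ℂ) :
    MeasurePreserving (fun Z : Matrix (Fin r) (Fin n) ℂ => Z * U) (GM r n) (GM r n) :=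
  measurePreserving_pi (fun _ : Fin r => Gam n) (fun _ : Fin r => Gam n)
    (f := fun _ z => z ᵥ* U) (fun _ => (vecMul_mp hU).2)

lemma GM_comp {r n m : ℕ} (e : Fin n → Fin m) (he : Function.Injective e) :
    MeasurePreserving (fun Z : Matrix (Fin r) (Fin m) ℂ => Z.submatrix id e) (GM r m) (GM r n) :=
  measurePreserving_pi (fun _ : Fin r => Gam m) (fun _ : Fin r => Gam n)
    (f := fun _ z i => z (e i)) (fun _ => Gam_comp e he)

lemma mp_integral {α β : Type*} [MeasurableSpace α] [MeasurableSpace β] {μ : Measure α}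
    {ν : Measure β} {f : α → β} (hf : MeasurePreserving f μ ν) {F : β → ℂ} (hF : Measurable F) :
    ∫ a, F (f a) ∂μ = ∫ b, F b ∂ν := by
  rw [← hf.map_eq, integral_map hf.measurable.aemeasurable hF.aestronglyMeasurable]

def Ssq {r n : ℕ} (Z : Matrix (Fin r) (Fin n) ℂ) : ℝ := ∑ i, ∑ j, ‖Z i j‖ ^ 2

lemma Ssq_nonneg {r n : ℕ} (Z : Matrix (Fin r) (Fin n) ℂ) : 0 ≤ Ssq Z := by
  unfold Ssq; positivity

lemma entry_le_Ssq {r n : ℕ} (Z : Matrix (Fin r) (Fin n) ℂ) (i : Fin r) (j : Fin n) :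
    ‖Z i j‖ ≤ √(Ssq Z) := by
  refine Real.le_sqrt_of_sq_le ?_
  calc ‖Z i j‖ ^ 2 ≤ ∑ j, ‖Z i j‖ ^ 2 := Finset.single_le_sum (f := fun j => ‖Z i j‖ ^ 2)
        (fun _ _ => by positivity) (Finset.mem_univ j)
    _ ≤ _ := Finset.single_le_sum (f := fun i => ∑ j, ‖Z i j‖ ^ 2)
        (fun _ _ => by positivity) (Finset.mem_univ i)

lemma Gam_exp_int (n : ℕ) :
    Integrable (fun z : Fin n → ℂ => ∏ j, Real.exp (‖z j‖ ^ 2 / 2)) (Gam n) := by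
  unfold Gam
  exact Integrable.fintype_prod (μ := fun _ : Fin n => gam)
      (f := fun _ z => Real.exp (‖z‖ ^ 2 / 2)) (fun _ => gam_exp_integrable)

lemma GM_exp_int' (r n : ℕ) :
    Integrable (fun Z : Fin r → Fin n → ℂ => ∏ i, ∏ j, Real.exp (‖Z i j‖ ^ 2 / 2))
      (Measure.pi fun _ : Fin r => Gam n) := by
  have h1 := Gam_exp_int n
  generalize hF : (fun z : Fin n → ℂ => ∏ j, Real.exp (‖z j‖ ^ 2 / 2)) = F at h1
  have h2 : Integrable (fun Z : Fin r → Fin n → ℂ => ∏ i, F (Z i))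
      (Measure.pi fun _ : Fin r => Gam n) :=
    Integrable.fintype_prod (μ := fun _ : Fin r => Gam n) (f := fun _ => F) (fun _ => h1)
  subst hF
  exact h2

lemma Ssq_exp {r n : ℕ} (Z : Matrix (Fin r) (Fin n) ℂ) :
    ∏ i, ∏ j, Real.exp (‖Z i j‖ ^ 2 / 2) = Real.exp (Ssq Z / 2) := by
  simp only [Ssq, ← Real.exp_sum, Finset.sum_div]

lemma GM_exp_int (r n : ℕ) : Integrable (fun Z => Real.exp (Ssq Z / 2)) (GM r n) := by
  simp only [← Ssq_exp]
  exact GM_exp_int' r n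

lemma rpow_le_exp {c N : ℝ} (hc : 0 ≤ c) (hN : 0 ≤ N) :
    ∃ C : ℝ, 0 ≤ C ∧ ∀ S : ℝ, 0 ≤ S → (1 + c * S) ^ N ≤ C * Real.exp (S / 2) := by
  set M := N + 1 with hM
  have hM0 : 0 < M := by positivity
  refine ⟨(1 + 2 * c * M) ^ M, by positivity, fun S hS => ?_⟩
  have h1 : (1 + c * S) ≤ (1 + 2 * c * M) * Real.exp (S / (2 * M)) := by
    have h2 := Real.add_one_le_exp (S / (2 * M))
    have h3 : (1 + c * S) ≤ (1 + 2 * c * M) * (S / (2 * M) + 1) := by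
      have : (1 + 2 * c * M) * (S / (2 * M) + 1) = 1 + c * S + (S / (2 * M) + 2 * c * M) := by
        field_simp
        ring
      rw [this]
      have : 0 ≤ S / (2 * M) + 2 * c * M := by positivity
      linarith
    exact h3.trans (mul_le_mul_of_nonneg_left h2 (by positivity))
  calc (1 + c * S) ^ N ≤ (1 + c * S) ^ M :=
        Real.rpow_le_rpow_of_exponent_le (by nlinarith [mul_nonneg hc hS]) (by linarith)
    _ ≤ ((1 + 2 * c * M) * Real.exp (S / (2 * M))) ^ M :=
        Real.rpow_le_rpow (by positivity) h1 hM0.le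
    _ = _ := by
        rw [Real.mul_rpow (by positivity) (by positivity), ← Real.exp_mul]
        congr 2
        field_simp

lemma sP_exp_bound (l r : ℕ) (σ : ℕ → ℂ) (hσ : ∀ j < r, 0 ≤ (σ j).re) {c : ℝ} (hc : 0 ≤ c) :
    ∃ C : ℝ, 0 ≤ C ∧ ∀ (y : Matrix (Fin l) (Fin l) ℂ) (S : ℝ), 0 ≤ S →
      (∀ i j, ‖y i j‖ ≤ c * S) → ‖sP r 0 σ y‖ ≤ C * Real.exp (S / 2) := by
  obtain ⟨K, N, hK, hN, h⟩ := sP_bound l r σ hσ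
  obtain ⟨C, hC, h2⟩ := rpow_le_exp hc hN
  refine ⟨K * C, by positivity, fun y S hS hy => ?_⟩
  refine (h 0 y (c * S) (by positivity) hy).trans ?_
  rw [mul_assoc]
  exact mul_le_mul_of_nonneg_left (h2 S hS) hK

lemma GG_integrable (r n : ℕ) (σ : ℕ → ℂ) (hσ : ∀ j < r, 0 ≤ (σ j).re) :
    Integrable (fun Z => sP r 0 σ (Z * Zᴴ)) (GM r n) := by
  obtain ⟨C, hC, h⟩ := sP_exp_bound r r σ hσ (c := n) (by positivity)
  refine Integrable.mono' ((GM_exp_int r n).const_mul C)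
    ((MM_id.mul MM_id.ct).sP r 0 σ).aestronglyMeasurable (Eventually.of_forall fun Z => ?_)
  refine h _ _ (Ssq_nonneg Z) fun i j => ?_
  have := mul_bd (Real.sqrt_nonneg _) (entry_le_Ssq Z) (ct_bd (entry_le_Ssq Z)) i j
  rwa [Real.mul_self_sqrt (Ssq_nonneg Z)] at this

lemma GG_haar {r n m : ℕ} (hn : n ≤ m) (hr : r ≤ m) (σ : ℕ → ℂ)
    (hσ : ∀ j < r, 0 ≤ (σ j).re)
    {μ : Measure (Matrix (Fin m) (Fin m) ℂ)} (hμ : IsHaarUnitary m μ) :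
    GG r n σ = GG r m σ * ∫ k, sP r 0 σ (k * projMat m n * kᴴ) ∂μ := by
  have := hμ.1
  have h0 : GG r m σ * ∫ k, sP r 0 σ (k * projMat m n * kᴴ) ∂μ =
      ∫ Z, ∫ k, sP r 0 σ (Z * (k * projMat m n * kᴴ) * Zᴴ) ∂μ ∂(GM r m) := by
    unfold GG
    rw [← integral_mul_const]
    refine integral_congr_ae (Eventually.of_forall fun Z => ?_)
    exact (haar_factor hμ 0 σ Z (projMat m n) le_rfl hr).symm
  rw [h0, integral_integral_swap]
  · have h1 : ∀ᵐ k ∂μ, ∫ Z, sP r 0 σ (Z * (k * projMat m n * kᴴ) * Zᴴ) ∂(GM r m) = GG r n σ := by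
      filter_upwards [hμ.ae] with k hk
      have h2 := mp_integral (GM_mul (r := r) hk)
        (F := fun Z => sP r 0 σ (Z * projMat m n * Zᴴ))
        (((MM_id.mul (MM.const _)).mul MM_id.ct).sP r 0 σ)
      have h3 := mp_integral (GM_comp (r := r) (Fin.castLE hn) (Fin.castLE_injective hn))
        (F := fun Z => sP r 0 σ (Z * Zᴴ)) ((MM_id.mul MM_id.ct).sP r 0 σ)
      have h4 : ∀ Z : Matrix (Fin r) (Fin m) ℂ, Z.submatrix id (Fin.castLE hn) *
          (Z.submatrix id (Fin.castLE hn))ᴴ = Z * projMat m n * Zᴴ := by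
        intro Z
        ext i j
        rw [Matrix.mul_apply, Matrix.mul_apply]
        simp only [projMat, Matrix.mul_diagonal, submatrix_apply, id, conjTranspose_apply]
        refine Fintype.sum_of_injective (Fin.castLE hn) (Fin.castLE_injective hn) _ _ ?_ ?_
        · intro u hu
          rw [if_neg, mul_zero, zero_mul]
          intro h
          exact hu ⟨⟨u, h⟩, by ext; simp⟩
        · intro u
          simp
      rw [GG, ← h3]
      simp only [h4]
      rw [← h2]
      simp only [Matrix.conjTranspose_mul, Matrix.mul_assoc]
    rw [integral_congr_ae h1]
    simp
  · obtain ⟨C, hC, h⟩ := sP_exp_bound r r σ hσ (c := m * (m * (m * (m * (1 * 1) * 1)))) (by positivity)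
    have hMM : MM (fun z : Matrix (Fin r) (Fin m) ℂ × Matrix (Fin m) (Fin m) ℂ =>
        z.1 * (z.2 * projMat m n * z.2ᴴ) * z.1ᴴ) := by
      have m1 := MM.of_meas (measurable_fst (α := Matrix (Fin r) (Fin m) ℂ) (β := Matrix (Fin m) (Fin m) ℂ))
      have m2 := MM.of_meas (measurable_snd (α := Matrix (Fin r) (Fin m) ℂ) (β := Matrix (Fin m) (Fin m) ℂ))
      exact (m1.mul ((m2.mul (MM.const _)).mul m2.ct)).mul m1.ct
    have hI : Integrable (fun z : Matrix (Fin r) (Fin m) ℂ × Matrix (Fin m) (Fin m) ℂ =>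
        C * Real.exp (Ssq z.1 / 2)) ((GM r m).prod μ) :=
      ((GM_exp_int r m).const_mul C).comp_fst μ
    refine Integrable.mono' hI (hMM.sP r 0 σ).aestronglyMeasurable ?_
    have e2 : ∀ᵐ z ∂((GM r m).prod μ), z.2 ∈ Matrix.unitaryGroup (Fin m) ℂ :=
      Measure.quasiMeasurePreserving_snd.ae hμ.ae
    filter_upwards [e2] with z hz
    refine h _ _ (Ssq_nonneg z.1) fun i j => ?_
    have hP : ∀ i j, ‖projMat m n i j‖ ≤ 1 := by
      intro i j
      unfold projMat
      rw [Matrix.diagonal_apply]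
      split_ifs <;> simp
    have hk := unit_bd hz
    have := mul_bd (by positivity) (mul_bd (Real.sqrt_nonneg _) (entry_le_Ssq z.1)
      (mul_bd (by positivity) (mul_bd zero_le_one hk hP) (ct_bd hk))) (ct_bd (entry_le_Ssq z.1)) i j
    refine this.trans (le_of_eq ?_)
    have e := Real.mul_self_sqrt (Ssq_nonneg z.1)
    linear_combination (m * (m * (m * (m * (1 * 1) * 1))) : ℝ) * e

lemma det_first {j : ℕ} (M : Matrix (Fin (j + 1)) (Fin (j + 1)) ℂ) (h : ∀ k : Fin j, M 0 k.succ = 0) :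
    M.det = M 0 0 * (M.submatrix Fin.succ Fin.succ).det := by
  rw [Matrix.det_succ_row_zero, Fin.sum_univ_succ]
  simp [h]

lemma pminor_self_tri {a m : ℕ} (T : Matrix (Fin a) (Fin m) ℂ)
    (hT : ∀ i j, i.val < j.val → T i j = 0) {j : ℕ} (ha : j ≤ a) (hm : j ≤ m) :
    pminor (T * Tᴴ) j = Complex.normSq (T.submatrix (Fin.castLE ha) (Fin.castLE hm)).det := by
  have := tri_sub T hT 1 ha hm
  rw [Matrix.mul_one] at this
  rw [pminor_eq _ ha, this, Matrix.submatrix_one _ (Fin.castLE_injective hm), Matrix.mul_one,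
    det_mul, det_conjTranspose]
  have : ∀ z : ℂ, z * star z = (Complex.normSq z : ℂ) := fun z => by simpa using Complex.mul_conj z
  rw [this, Complex.ofReal_re]

lemma sP_first {r n : ℕ} (σ : ℕ → ℂ) (A : Matrix (Fin (r + 1)) (Fin (n + 1)) ℂ)
    (hA : ∀ j : Fin n, A 0 j.succ = 0) :
    sP (r + 1) 0 σ (A * Aᴴ) = Ff 0 (∑ j ∈ range (r + 1), σ j) (‖A 0 0‖ ^ 2) *
      sP r 0 (fun j => σ (j + 1))
        (A.submatrix Fin.succ Fin.succ * (A.submatrix Fin.succ Fin.succ)ᴴ) := by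
  set W := A.submatrix Fin.succ Fin.succ with hW
  let T : Matrix (Fin (r + 1)) (Fin (r + 1)) ℂ := Matrix.of fun i j =>
    Fin.cases (motive := fun _ => ℂ) (A i 0) (fun j' => if i = j'.succ then 1 else 0) j
  let Y : Matrix (Fin (r + 1)) (Fin (n + 1)) ℂ := Matrix.of fun i j =>
    Fin.cases (motive := fun _ => ℂ) (if j = 0 then 1 else 0)
      (fun i' => Fin.cases (motive := fun _ => ℂ) 0 (fun j' => W i' j') j) i
  have hAT : A = T * Y := by
    ext i j
    rw [Matrix.mul_apply, Fin.sum_univ_succ]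
    refine Fin.cases ?_ (fun i' => ?_) i
    · refine Fin.cases ?_ (fun j' => ?_) j
      · simp [T, Y]
      · simp [T, Y, hA, (Fin.succ_ne_zero _).symm]
    · refine Fin.cases ?_ (fun j' => ?_) j
      · simp [T, Y]
      · simp [T, Y, hW]
  have hT : ∀ i j, i.val < j.val → T i j = 0 := by
    intro i j
    refine Fin.cases ?_ (fun j' => ?_) j
    · simp
    · intro h
      simp only [T, Matrix.of_apply, Fin.cases_succ]
      rw [if_neg]
      rintro rfl
      exact lt_irrefl _ h
  have h1 : A * Aᴴ = T * (Y * Yᴴ) * Tᴴ := by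
    rw [hAT, Matrix.conjTranspose_mul]
    simp only [Matrix.mul_assoc]
  have h2 : ∀ j, j < r + 1 → pminor (T * Tᴴ) (j + 1) = ‖A 0 0‖ ^ 2 := by
    intro j hj
    rw [pminor_self_tri T hT (j := j + 1) hj hj, det_first]
    · have : (T.submatrix (Fin.castLE hj) (Fin.castLE hj)).submatrix Fin.succ Fin.succ = 1 := by
        ext u v
        simp only [T, submatrix_apply, of_apply, Matrix.one_apply]
        have e : Fin.castLE hj v.succ = (Fin.castLE (Nat.lt_succ_iff.mp hj) v).succ := by ext; simp
        have e' : Fin.castLE hj u.succ = (Fin.castLE (Nat.lt_succ_iff.mp hj) u).succ := by ext; simp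
        rw [e, e', Fin.cases_succ]
        simp [Fin.ext_iff]
      rw [this, Matrix.det_one, mul_one, Complex.normSq_eq_norm_sq]
      simp only [T, submatrix_apply, of_apply]
      have e0 : Fin.castLE hj (0 : Fin (j + 1)) = 0 := by ext; simp
      rw [e0, Fin.cases_zero]
    · intro k
      show T (Fin.castLE hj 0) (Fin.castLE hj k.succ) = 0
      exact hT _ _ (by simp)
  have h3 : ∀ j, j < r + 1 → pminor (Y * Yᴴ) (j + 1) = pminor (W * Wᴴ) j := by
    intro j hj
    have hj' : j ≤ r := Nat.lt_succ_iff.mp hj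
    have c0 : (Y * Yᴴ) 0 0 = 1 := by
      rw [Matrix.mul_apply, Fin.sum_univ_succ]
      simp [Y]
    have cs : ∀ v : Fin r, (Y * Yᴴ) 0 v.succ = 0 := by
      intro v
      rw [Matrix.mul_apply, Fin.sum_univ_succ]
      simp [Y]
    have css : ∀ u v : Fin r, (Y * Yᴴ) u.succ v.succ = (W * Wᴴ) u v := by
      intro u v
      rw [Matrix.mul_apply, Fin.sum_univ_succ]
      simp [Y, Matrix.mul_apply]
    have e0 : Fin.castLE hj (0 : Fin (j + 1)) = 0 := by ext; simp
    have es : ∀ v : Fin j, Fin.castLE hj v.succ = (Fin.castLE hj' v).succ := by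
      intro v; ext; simp
    rw [pminor_eq _ (j := j + 1) hj, pminor_eq _ hj', det_first]
    · have : ((Y * Yᴴ).submatrix (Fin.castLE hj) (Fin.castLE hj)).submatrix Fin.succ Fin.succ =
          (W * Wᴴ).submatrix (Fin.castLE hj') (Fin.castLE hj') := by
        ext u v
        simp only [submatrix_apply, es, css]
      rw [this, submatrix_apply, e0, c0, one_mul]
    · intro k
      rw [submatrix_apply, e0, es, cs]
  rw [h1, sP_tri 0 σ T hT _ le_rfl le_rfl]
  congr 1
  · unfold sP
    rw [← Ff_zero_prod _ _ ⟨0, by simp⟩]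
    refine Finset.prod_congr rfl fun j hj => ?_
    rw [h2 j (Finset.mem_range.mp hj)]
    rfl
  · unfold sP
    rw [Finset.prod_range_succ']
    have : pminor (Y * Yᴴ) (0 + 1) = 1 := by
      rw [h3 0 (by omega), pminor_eq _ (Nat.zero_le _)]
      simp
    rw [this]
    simp only [Pi.zero_apply, Ff_one, mul_one]
    refine Finset.prod_congr rfl fun j hj => ?_
    rw [h3 (j + 1) (by have := Finset.mem_range.mp hj; omega)]

lemma GG_succ (r n : ℕ) (σ : ℕ → ℂ) (hσ : ∀ j < r + 1, 0 ≤ (σ j).re) :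
    GG (r + 1) (n + 1) σ =
      Mom (n + 1) (∑ j ∈ range (r + 1), σ j) * GG r n (fun j => σ (j + 1)) := by
  let H : Matrix (Fin (r + 1)) (Fin (n + 1)) ℂ → ℂ := fun Z => sP (r + 1) 0 σ (Z * Zᴴ)
  have hH : Measurable H := (MM_id.mul MM_id.ct).sP (r + 1) 0 σ
  let E := MeasurableEquiv.piFinSuccAbove (fun _ : Fin (r + 1) => Fin (n + 1) → ℂ) 0
  have hE : MeasurePreserving E.symm ((Gam (n + 1)).prod (Measure.pi fun _ : Fin r => Gam (n + 1))) (GM (r + 1) (n + 1)) :=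
    (measurePreserving_piFinSuccAbove (fun _ : Fin (r + 1) => Gam (n + 1)) 0).symm
  have h1 : GG (r + 1) (n + 1) σ = ∫ p, H (E.symm p) ∂((Gam (n + 1)).prod (Measure.pi fun _ : Fin r => Gam (n + 1))) :=
    (mp_integral hE hH).symm
  have hintg : Integrable (fun p => H (E.symm p)) ((Gam (n + 1)).prod (Measure.pi fun _ : Fin r => Gam (n + 1))) :=
    hE.integrable_comp_of_integrable (GG_integrable _ _ σ hσ)
  rw [h1, integral_prod _ hintg]
  unfold Mom
  rw [← integral_mul_const]
  refine integral_congr_ae (Eventually.of_forall fun z => ?_)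
  simp only
  obtain ⟨T, q, hq, hTq, hT⟩ := qr (Matrix.of fun _ : Fin 1 => z)
  have hqq : q * qᴴ = 1 := Matrix.mem_unitaryGroup_iff.mp hq
  have hz : z = T 0 ᵥ* q := by
    have := congrFun hTq 0
    rw [Matrix.mul_apply_eq_vecMul] at this
    exact this
  have hnz : nsq z = ‖T 0 0‖ ^ 2 := by
    rw [hz, nsq_vecMul hq, nsq, Fin.sum_univ_succ]
    simp [hT]
  let A : Matrix (Fin r) (Fin (n + 1)) ℂ → Matrix (Fin (r + 1)) (Fin (n + 1)) ℂ := fun Z =>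
    Matrix.of (Fin.cons (T 0) Z)
  have hEs : ∀ Z : Matrix (Fin r) (Fin (n + 1)) ℂ, E.symm (z, Z * q) = A Z * q := by
    intro Z
    funext i
    refine Fin.cases ?_ (fun i' => ?_) i
    · rw [Matrix.mul_apply_eq_vecMul]
      exact hz
    · rw [Matrix.mul_apply_eq_vecMul]
      rfl
  have h2 := mp_integral (GM_mul (r := r) hq) (F := fun Z => H (E.symm (z, Z)))
    (hH.comp (E.symm.measurable.comp (measurable_const.prodMk measurable_id)))
  refine h2.symm.trans ?_
  have h3 : ∀ Z : Matrix (Fin r) (Fin (n + 1)) ℂ, H (E.symm (z, Z * q)) =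
      Ff 0 (∑ j ∈ range (r + 1), σ j) (nsq z) * sP r 0 (fun j => σ (j + 1))
        (Z.submatrix id Fin.succ * (Z.submatrix id Fin.succ)ᴴ) := by
    intro Z
    rw [hEs]
    have : (A Z * q) * (A Z * q)ᴴ = A Z * (A Z)ᴴ := by
      rw [Matrix.conjTranspose_mul, Matrix.mul_assoc, ← Matrix.mul_assoc q, hqq, Matrix.one_mul]
    simp only [H]
    rw [this, sP_first σ (A Z), hnz]
    · rfl
    · intro j
      exact hT _ _ (by simp)
  simp only [h3]
  rw [integral_const_mul]
  congr 1
  exact mp_integral (GM_comp (r := r) (Fin.succ (n := n)) (Fin.succ_injective n))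
    (F := fun Z => sP r 0 (fun j => σ (j + 1)) (Z * Zᴴ)) ((MM_id.mul MM_id.ct).sP r 0 _)

lemma GG_ne_zero : ∀ (r n : ℕ) (σ : ℕ → ℂ), r ≤ n → (∀ j < r, 0 ≤ (σ j).re) → GG r n σ ≠ 0
  | 0, n, σ, _, _ => by simp [GG, sP]
  | r + 1, 0, σ, h, _ => by omega
  | r + 1, n + 1, σ, h, hσ => by
    rw [GG_succ r n σ hσ]
    refine mul_ne_zero (Mom_ne_zero (by omega) ?_)
      (GG_ne_zero r n _ (by omega) fun j hj => hσ _ (by omega))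
    rw [Complex.re_sum]
    exact Finset.sum_nonneg fun j hj => hσ j (Finset.mem_range.mp hj)

lemma exists_det_ne {m j : ℕ} {x : Matrix (Fin m) (Fin m) ℂ} (hx : x.IsHermitian) (hj : j ≤ x.rank) :
    ∃ Z : Matrix (Fin j) (Fin m) ℂ, (Z * x * Zᴴ).det ≠ 0 := by
  rw [hx.rank_eq_card_non_zero_eigs] at hj
  have hj' : Fintype.card (Fin j) ≤ Fintype.card {i // hx.eigenvalues i ≠ 0} := by simpa using hj
  obtain ⟨e⟩ := Function.Embedding.nonempty_of_card_le hj'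
  have hsp := hx.conjStarAlgAut_star_eigenvectorUnitary
  rw [Unitary.conjStarAlgAut_apply] at hsp
  set U : Matrix (Fin m) (Fin m) ℂ := (hx.eigenvectorUnitary).1 with hU
  have hsp' : Uᴴ * x * U = diagonal (RCLike.ofReal ∘ hx.eigenvalues) := by
    simpa [← Matrix.star_eq_conjTranspose] using hsp
  refine ⟨Uᴴ.submatrix (fun i => (e i : Fin m)) id, ?_⟩
  have h1 : Uᴴ.submatrix (fun i => (e i : Fin m)) id * x *
      (Uᴴ.submatrix (fun i => (e i : Fin m)) id)ᴴ =
      (Uᴴ * x * U).submatrix (fun i => (e i : Fin m)) (fun i => (e i : Fin m)) := by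
    ext a b
    simp [Matrix.mul_apply]
  rw [h1, hsp', Matrix.submatrix_diagonal _ (fun i => (e i : Fin m))
    (Subtype.val_injective.comp e.injective), Matrix.det_diagonal]
  refine Finset.prod_ne_zero_iff.mpr fun i _ => ?_
  simpa using (e i).2

open Polynomial in
lemma line_finite {m j : ℕ} (x : Matrix (Fin m) (Fin m) ℂ) (Z Z1 : Matrix (Fin j) (Fin m) ℂ)
    (h1 : (Z1 * x * Z1ᴴ).det ≠ 0) :
    {t : ℝ | ((Z + t • Z1) * x * (Z + t • Z1)ᴴ).det = 0}.Finite := by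
  let Q : ℂ[X] := ((Z1.map C + (X : ℂ[X]) • Z.map C) * x.map C *
    (Z1ᴴ.map C + (X : ℂ[X]) • Zᴴ.map C)).det
  have hQ : ∀ u : ℝ, Q.eval (u : ℂ) = ((Z1 + u • Z) * x * (Z1 + u • Z)ᴴ).det := by
    intro u
    have : Q.eval (u : ℂ) = (Polynomial.evalRingHom (u : ℂ)) Q := rfl
    rw [this, RingHom.map_det]
    congr 1
    ext a b
    simp [Matrix.mul_apply, Polynomial.eval_finsetSum, mul_comm (u : ℂ)]
  have hQ0 : Q ≠ 0 := by
    intro h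
    have := hQ 0
    rw [h] at this
    simp at this
    exact h1 this.symm
  have hf : ((fun u : ℝ => (u : ℂ)) ⁻¹' {z | Q.IsRoot z}).Finite :=
    (Polynomial.finite_setOfPred_isRoot hQ0).preimage Complex.ofReal_injective.injOn
  refine ((hf.preimage (f := fun t : ℝ => t⁻¹) inv_injective.injOn).union
    (Set.finite_singleton 0)).subset ?_
  intro t ht
  by_cases h0 : t = 0
  · right; exact h0
  left
  simp only [Set.mem_preimage, Set.mem_ofPred_eq, Polynomial.IsRoot.def] at ht ⊢
  rw [hQ]
  have e : Z1 + t⁻¹ • Z = t⁻¹ • (Z + t • Z1) := by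
    rw [smul_add, smul_smul, inv_mul_cancel₀ h0, one_smul, add_comm]
  rw [e, Matrix.conjTranspose_smul, Matrix.smul_mul, Matrix.smul_mul, Matrix.mul_smul]
  have : ∀ (c : ℝ) (M : Matrix (Fin j) (Fin j) ℂ), (c • M).det = (c : ℂ) ^ j * M.det := by
    intro c M
    have : c • M = (c : ℂ) • M := by ext; simp
    rw [this, Matrix.det_smul, Fintype.card_fin]
  rw [this, this, ht]
  simp

abbrev VV (j m : ℕ) := Fin j → Fin m → ℂ

instance VV_haar (j m : ℕ) : (volume : Measure (VV j m)).IsAddHaarMeasure := by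
  have : ∀ _ : Fin j, (volume : Measure (Fin m → ℂ)).IsAddHaarMeasure := fun _ => inferInstance
  exact Measure.pi.isAddHaarMeasure (fun _ : Fin j => (volume : Measure (Fin m → ℂ)))

lemma MM.det {α : Type*} [MeasurableSpace α] {l : ℕ} {f : α → Matrix (Fin l) (Fin l) ℂ}
    (hf : MM f) : Measurable fun t => (f t).det := by
  simp only [Matrix.det_apply]
  refine Finset.measurable_sum _ fun π _ => ?_
  refine Measurable.const_smul ?_ _
  exact Finset.measurable_prod _ fun u _ => hf _ _

lemma MM_VV (j m : ℕ) : MM (fun Z : VV j m => (Matrix.of Z : Matrix (Fin j) (Fin m) ℂ)) :=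
  fun a b => (measurable_pi_apply b).comp (measurable_pi_apply (X := fun _ : Fin j => Fin m → ℂ) a)

lemma vol_null {m j : ℕ} {x : Matrix (Fin m) (Fin m) ℂ} (hx : x.IsHermitian) (hj : j ≤ x.rank) :
    ∀ᵐ Z : VV j m, ((Matrix.of Z) * x * (Matrix.of Z)ᴴ).det ≠ 0 := by
  obtain ⟨Z1, h1⟩ := exists_det_ne hx hj
  have hs : MeasurableSet {Z : VV j m | ((Matrix.of Z) * x * (Matrix.of Z)ᴴ).det ≠ 0} := by
    have : Measurable fun Z : VV j m => ((Matrix.of Z) * x * (Matrix.of Z)ᴴ).det :=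
      (((MM_VV j m).mul (MM.const x)).mul (MM_VV j m).ct).det
    exact (this (measurableSet_singleton 0)).compl
  let Lm : ℝ →ₗ[ℝ] VV j m := LinearMap.toSpanSingleton ℝ (VV j m) Z1
  refine ae_mem_of_ae_add_linearMap_mem Lm volume volume hs fun Z => ?_
  have hfin := line_finite x (Matrix.of Z) Z1 h1
  have := hfin.measure_zero volume
  rw [ae_iff]
  refine measure_mono_null (fun t ht => ?_) this
  by_contra hne
  exact ht hne

lemma VV_mp {j m : ℕ} {U : Matrix (Fin m) (Fin m) ℂ} (hU : U ∈ Matrix.unitaryGroup (Fin m) ℂ) :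
    MeasurePreserving (fun Z : VV j m => fun i => Z i ᵥ* U) volume volume :=
  measurePreserving_pi (fun _ : Fin j => (volume : Measure (Fin m → ℂ)))
    (fun _ : Fin j => (volume : Measure (Fin m → ℂ)))
    (f := fun _ z => z ᵥ* U) (fun _ => (vecMul_mp hU).1)

lemma minor_ae {m j : ℕ} {μ : Measure (Matrix (Fin m) (Fin m) ℂ)} (hμ : IsHaarUnitary m μ)
    {x : Matrix (Fin m) (Fin m) ℂ} (hx : x.IsHermitian) (hj : j ≤ x.rank) :
    ∀ᵐ k ∂μ, pminor (k * x * kᴴ) j ≠ 0 := by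
  have := hμ.1
  have hjm : j ≤ m := by simpa using hj.trans (Matrix.rank_le_width x)
  have hmeas : MeasurableSet {p : VV j m × Matrix (Fin m) (Fin m) ℂ |
      ((Matrix.of p.1 * p.2) * x * (Matrix.of p.1 * p.2)ᴴ).det ≠ 0} := by
    have m1 : MM (fun p : VV j m × Matrix (Fin m) (Fin m) ℂ =>
        (Matrix.of p.1 : Matrix (Fin j) (Fin m) ℂ)) := fun a b => (MM_VV j m a b).comp measurable_fst
    have m2 : MM (fun p : VV j m × Matrix (Fin m) (Fin m) ℂ => p.2) := MM.of_meas measurable_snd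
    have : Measurable fun p : VV j m × Matrix (Fin m) (Fin m) ℂ =>
        ((Matrix.of p.1 * p.2) * x * (Matrix.of p.1 * p.2)ᴴ).det :=
      (((m1.mul m2).mul (MM.const x)).mul (m1.mul m2).ct).det
    exact (this (measurableSet_singleton 0)).compl
  have h1 : ∀ᵐ k ∂μ, ∀ᵐ Z : VV j m,
      ((Matrix.of Z * k) * x * (Matrix.of Z * k)ᴴ).det ≠ 0 := by
    filter_upwards [hμ.ae] with k hk
    exact (VV_mp hk).quasiMeasurePreserving.ae (vol_null hx hj)
  have h2 : ∀ᵐ Z : VV j m, ∀ᵐ k ∂μ,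
      ((Matrix.of Z * k) * x * (Matrix.of Z * k)ᴴ).det ≠ 0 :=
    (Measure.ae_ae_comm hmeas).mpr h1
  obtain ⟨Z, hZ⟩ := h2.exists
  obtain ⟨T, q, hq, hTq, hT⟩ := qr (Matrix.of Z : Matrix (Fin j) (Fin m) ℂ)
  have h3 : ∀ᵐ k ∂μ, pminor ((q * k) * x * (q * k)ᴴ) j ≠ 0 := by
    filter_upwards [hZ] with k hk
    have e : (Matrix.of Z * k) * x * (Matrix.of Z * k)ᴴ = T * ((q * k) * x * (q * k)ᴴ) * Tᴴ := by
      rw [hTq]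
      simp only [Matrix.conjTranspose_mul, Matrix.mul_assoc]
    intro h0
    apply hk
    rw [e]
    have hH : (T * ((q * k) * x * (q * k)ᴴ) * Tᴴ).IsHermitian :=
      Matrix.isHermitian_mul_mul_conjTranspose _ (Matrix.isHermitian_mul_mul_conjTranspose _ hx)
    have hp := (pminor_tri T hT ((q * k) * x * (q * k)ᴴ) le_rfl hjm).1
    rw [h0, mul_zero, pminor_eq _ le_rfl] at hp
    have hs : ∀ M : Matrix (Fin j) (Fin j) ℂ,
        M.submatrix (Fin.castLE le_rfl) (Fin.castLE le_rfl) = M := fun M => by ext; rfl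
    rw [hs] at hp
    have him : star (T * ((q * k) * x * (q * k)ᴴ) * Tᴴ).det =
        (T * ((q * k) * x * (q * k)ᴴ) * Tᴴ).det := by
      rw [← Matrix.det_conjTranspose, hH.eq]
    rw [← Complex.conj_eq_iff_re.mp him, hp, Complex.ofReal_zero]
  have hqs : qᴴ ∈ Matrix.unitaryGroup (Fin m) ℂ := Unitary.star_mem hq
  have hqq : q * qᴴ = 1 := Matrix.mem_unitaryGroup_iff.mp hq
  have h4 := (hμ.mp hqs).quasiMeasurePreserving.ae h3
  filter_upwards [h4] with k hk
  rwa [← Matrix.mul_assoc, hqq, Matrix.one_mul] at hk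

lemma Ff_parity {ε ε' : ℤ} (σ : ℂ) {p : ℝ} (h : Even (ε - ε')) : Ff ε σ p = Ff ε' σ p := by
  unfold Ff
  split_ifs with hp
  · rfl
  congr 1
  have e : ε = ε' + (ε - ε') := by ring
  rcases lt_or_gt_of_ne hp with h' | h'
  · rw [Real.sign_of_neg h', e, zpow_add₀ (by simp)]
    simp [h.neg_one_zpow]
  · simp [Real.sign_of_pos h']

lemma Ff_nonneg (ε : ℤ) (σ : ℂ) {p : ℝ} (h : 0 ≤ p) : Ff ε σ p = Ff 0 σ p := by
  unfold Ff
  split_ifs with hp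
  · rfl
  rw [Real.sign_of_pos (lt_of_le_of_ne h (Ne.symm hp))]
  simp

lemma Ff_triv {p : ℝ} (h : p ≠ 0) : Ff 0 0 p = 1 := by simp [Ff, h]

lemma sP_ext {r n l : ℕ} (hrn : r ≤ n) {ε ε' : ℕ → ℤ} {σ σ' : ℕ → ℂ}
    {y : Matrix (Fin l) (Fin l) ℂ} (hy : ∀ j < n, pminor y (j + 1) ≠ 0)
    (h1 : ∀ j < r, σ' j = σ j ∧ Even (ε' j - ε j))
    (h2 : ∀ j < n, r ≤ j → σ' j = 0 ∧ Even (ε' j)) : sP n ε' σ' y = sP r ε σ y := by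
  unfold sP
  have : ∏ j ∈ range r, Ff (ε j) (σ j) (pminor y (j + 1)) =
      ∏ j ∈ range r, Ff (ε' j) (σ' j) (pminor y (j + 1)) := by
    refine Finset.prod_congr rfl fun j hj => ?_
    obtain ⟨ha, hb⟩ := h1 j (Finset.mem_range.mp hj)
    rw [ha, Ff_parity _ hb]
  rw [this]
  refine (Finset.prod_subset (Finset.range_mono hrn) fun j hj hj' => ?_).symm
  have hjn := Finset.mem_range.mp hj
  obtain ⟨ha, hb⟩ := h2 j hjn (by simpa using hj')
  rw [ha, Ff_parity (ε' := 0) _ (by simpa using hb), Ff_triv (hy j hjn)]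

lemma sP_nonneg {n l : ℕ} (ε : ℕ → ℤ) (σ : ℕ → ℂ) {y : Matrix (Fin l) (Fin l) ℂ}
    (hy : ∀ j < n, 0 ≤ pminor y (j + 1)) : sP n ε σ y = sP n 0 σ y :=
  Finset.prod_congr rfl fun j hj => Ff_nonneg _ _ (hy j (Finset.mem_range.mp hj))

lemma sTilde_lt (n₁ n₂ : ℕ) (s : ℕ → ℂ) {j : ℕ} (hj : j < min n₁ n₂) :
    sTilde n₁ n₂ s j - sNext (max n₁ n₂) (sTilde n₁ n₂ s) j - 1 =
      s j - sNext (min n₁ n₂) s j - 1 := by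
  have hle : min n₁ n₂ ≤ max n₁ n₂ := min_le_max
  unfold sNext sTilde
  rw [← Nat.cast_max (α := ℤ)]
  generalize min n₁ n₂ = r at *
  generalize max n₁ n₂ = N at *
  rw [if_pos hj, Nat.cast_sub hle]
  by_cases h1 : j + 1 < r
  · rw [if_pos (by omega), if_pos h1, if_pos h1]
    ring
  · have hr : r = j + 1 := by omega
    subst hr
    by_cases h2 : j + 1 < N
    · rw [if_pos h2, if_neg h1, if_neg h1]
      push_cast
      ring
    · have : N = j + 1 := by omega
      subst this
      simp only [if_neg h2]
      push_cast
      ring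

lemma sTilde_ge (n₁ n₂ : ℕ) (s : ℕ → ℂ) {j : ℕ} (hj : min n₁ n₂ ≤ j) (hN : j < max n₁ n₂) :
    sTilde n₁ n₂ s j - sNext (max n₁ n₂) (sTilde n₁ n₂ s) j - 1 = 0 := by
  unfold sNext sTilde
  rw [← Nat.cast_max (α := ℤ)]
  generalize min n₁ n₂ = r at *
  generalize max n₁ n₂ = N at *
  rw [if_neg (by omega)]
  by_cases h2 : j + 1 < N
  · rw [if_pos h2, if_neg (by omega)]
    push_cast
    ring
  · have : N = j + 1 := by omega
    subst this
    rw [if_neg h2]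
    push_cast
    ring

lemma LTilde_lt (n₁ n₂ : ℕ) (L : ℕ → ℤ) {j : ℕ} (hj : j < min n₁ n₂) :
    Even ((LTilde n₁ n₂ L j - LNext (max n₁ n₂) (LTilde n₁ n₂ L) j - 1) -
      (L j - LNext (min n₁ n₂) L j - 1)) := by
  have hle : min n₁ n₂ ≤ max n₁ n₂ := min_le_max
  unfold LNext LTilde
  rw [← Nat.cast_max (α := ℤ)]
  generalize min n₁ n₂ = r at *
  generalize max n₁ n₂ = N at *
  rw [if_pos hj, Nat.cast_sub hle, Int.even_iff]
  split_ifs <;> omega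

lemma LTilde_ge (n₁ n₂ : ℕ) (L : ℕ → ℤ) {j : ℕ} (hj : min n₁ n₂ ≤ j) (hN : j < max n₁ n₂) :
    Even (LTilde n₁ n₂ L j - LNext (max n₁ n₂) (LTilde n₁ n₂ L) j - 1) := by
  unfold LNext LTilde
  rw [← Nat.cast_max (α := ℤ)]
  generalize min n₁ n₂ = r at *
  generalize max n₁ n₂ = N at *
  rw [if_neg (by omega), Int.even_iff]
  split_ifs <;> omega

lemma minors_ae {m n : ℕ} {μ : Measure (Matrix (Fin m) (Fin m) ℂ)} (hμ : IsHaarUnitary m μ)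
    {x : Matrix (Fin m) (Fin m) ℂ} (hx : x.IsHermitian) (hn : n ≤ x.rank) :
    ∀ᵐ k ∂μ, ∀ j < n, pminor (k * x * kᴴ) (j + 1) ≠ 0 := by
  have : ∀ j : ℕ, ∀ᵐ k ∂μ, j < n → pminor (k * x * kᴴ) (j + 1) ≠ 0 := by
    intro j
    by_cases hj : j < n
    · filter_upwards [minor_ae hμ hx (j := j + 1) (by omega)] with k hk _ using hk
    · exact Eventually.of_forall fun k h => absurd h hj
  exact ae_all_iff.mpr this

lemma projMat_herm (l n : ℕ) : (projMat l n).IsHermitian := by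
  unfold projMat
  refine Matrix.isHermitian_diagonal_of_self_adjoint _ ?_
  funext i
  simp only [Pi.star_apply]
  split_ifs <;> simp

lemma projMat_rank {l n : ℕ} (h : n ≤ l) : n ≤ (projMat l n).rank := by
  unfold projMat
  rw [Matrix.rank_diagonal]
  have : Function.Injective (fun i : Fin n => (⟨Fin.castLE h i, by simp⟩ :
      {i : Fin l // (if (i : ℕ) < n then (1 : ℂ) else 0) ≠ 0})) := by
    intro a b hab
    simpa [Fin.ext_iff] using hab
  simpa using Fintype.card_le_of_injective _ this

lemma gram_nonneg {l m n : ℕ} (g : Matrix (Fin l) (Fin m) ℂ) (h : Matrix (Fin l) (Fin l) ℂ)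
    (hl : n ≤ l) (hm : n ≤ m) : ∀ j < n, 0 ≤ pminor (h * (g * gᴴ) * hᴴ) (j + 1) := by
  intro j hj
  have e : h * (g * gᴴ) * hᴴ = (h * g) * (h * g)ᴴ := by
    rw [Matrix.conjTranspose_mul]
    simp only [Matrix.mul_assoc]
  obtain ⟨T, q, hq, hTq, hT⟩ := qr (h * g)
  have hqq : q * qᴴ = 1 := Matrix.mem_unitaryGroup_iff.mp hq
  rw [e, hTq, Matrix.conjTranspose_mul, Matrix.mul_assoc, ← Matrix.mul_assoc q, hqq, Matrix.one_mul]
  exact (pminor_tri T hT 1 (j := j + 1) (by omega) (by omega)).2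

lemma CsphT {l n : ℕ} {μ : Measure (Matrix (Fin l) (Fin l) ℂ)} (hμ : IsHaarUnitary l μ)
    (n₁ n₂ : ℕ) (s : ℕ → ℂ) (hn : n = max n₁ n₂) (hl : n ≤ l) :
    Csph l n μ (sTilde n₁ n₂ s) = ∫ k, sP (min n₁ n₂) 0
      (fun j => s j - sNext (min n₁ n₂) s j - 1) (k * projMat l n * kᴴ) ∂μ := by
  subst hn
  unfold Csph
  refine integral_congr_ae ?_
  filter_upwards [minors_ae hμ (projMat_herm _ _) (projMat_rank hl)] with k hk
  rw [absProd_eq]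
  exact sP_ext min_le_max hk (fun j hj => ⟨sTilde_lt n₁ n₂ s hj, by simp⟩)
    (fun j hj hr => ⟨sTilde_ge n₁ n₂ s hr hj, by simp⟩)

lemma NsphT {l n : ℕ} {μ : Measure (Matrix (Fin l) (Fin l) ℂ)} (hμ : IsHaarUnitary l μ)
    (n₁ n₂ : ℕ) (s : ℕ → ℂ) (L : ℕ → ℤ) (hn : n = max n₁ n₂)
    {x : Matrix (Fin l) (Fin l) ℂ} (hx : x.IsHermitian) (hr : n ≤ x.rank) :
    Nsph l n μ (sTilde n₁ n₂ s) (LTilde n₁ n₂ L) x = ∫ k, sP (min n₁ n₂)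
      (fun j => L j - LNext (min n₁ n₂) L j - 1)
      (fun j => s j - sNext (min n₁ n₂) s j - 1) (k * x * kᴴ) ∂μ := by
  subst hn
  unfold Nsph
  refine integral_congr_ae ?_
  filter_upwards [minors_ae hμ hx hr] with k hk
  rw [sphProd_eq]
  exact sP_ext min_le_max hk (fun j hj => ⟨sTilde_lt n₁ n₂ s hj, LTilde_lt n₁ n₂ L hj⟩)
    (fun j hj hr => ⟨sTilde_ge n₁ n₂ s hr hj, LTilde_ge n₁ n₂ L hr hj⟩)

lemma Nsph_gram {l m n : ℕ} {μ : Measure (Matrix (Fin l) (Fin l) ℂ)}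
    (s : ℕ → ℂ) (L : ℕ → ℤ) (g : Matrix (Fin l) (Fin m) ℂ) (hl : n ≤ l) (hm : n ≤ m) :
    Nsph l n μ s L (g * gᴴ) = ∫ k, sP n 0
      (fun j => s j - sNext n s j - 1) (k * (g * gᴴ) * kᴴ) ∂μ := by
  unfold Nsph
  refine integral_congr_ae (Eventually.of_forall fun k => ?_)
  exact sP_nonneg _ _ (gram_nonneg g k hl hm)

lemma NsphT_gram {l m n : ℕ} {μ : Measure (Matrix (Fin l) (Fin l) ℂ)} (hμ : IsHaarUnitary l μ)
    (n₁ n₂ : ℕ) (s : ℕ → ℂ) (L : ℕ → ℤ) (hn : n = max n₁ n₂)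
    (g : Matrix (Fin l) (Fin m) ℂ) (hl : n ≤ l) (hm : n ≤ m) (hg : n ≤ g.rank) :
    Nsph l n μ (sTilde n₁ n₂ s) L (g * gᴴ) = ∫ k, sP (min n₁ n₂) 0
      (fun j => s j - sNext (min n₁ n₂) s j - 1) (k * (g * gᴴ) * kᴴ) ∂μ := by
  rw [Nsph_gram _ _ _ hl hm]
  subst hn
  refine integral_congr_ae ?_
  have hr : max n₁ n₂ ≤ (g * gᴴ).rank := by
    open scoped ComplexOrder in
    rwa [Matrix.rank_self_mul_conjTranspose]
  filter_upwards [minors_ae hμ (Matrix.isHermitian_mul_conjTranspose_self g) hr] with k hk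
  exact sP_ext min_le_max hk (fun j hj => ⟨sTilde_lt n₁ n₂ s hj, by simp⟩)
    (fun j hj hr => ⟨sTilde_ge n₁ n₂ s hr hj, by simp⟩)

lemma Csph_eq (l n : ℕ) (μ : Measure (Matrix (Fin l) (Fin l) ℂ)) (s : ℕ → ℂ) :
    Csph l n μ s = ∫ k, sP n 0 (fun j => s j - sNext n s j - 1) (k * projMat l n * kᴴ) ∂μ := by
  unfold Csph
  simp only [absProd_eq]


/-- Factorization of the spherical function under the unitary average:
`∫_{U(m)} Φ_{l,r}(s,L; g k x k* g*) dk` splits into a product of spherical functions. -/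
theorem statement3 (l m n₁ n₂ : ℕ) (h1 : 1 ≤ n₁) (h2 : 1 ≤ n₂)
    (hn₁l : n₁ ≤ l) (hn₁m : n₁ ≤ m) (hn₂m : n₂ ≤ m)
    (g : Matrix (Fin l) (Fin m) ℂ) (hg : g.rank = n₁)
    (x : Matrix (Fin m) (Fin m) ℂ) (hx : x.IsHermitian) (hxr : x.rank = n₂)
    (s : ℕ → ℂ) (hs : ∀ j < min n₁ n₂, 1 ≤ (s j - sNext (min n₁ n₂) s j).re)
    (L : ℕ → ℤ) (hL : ∀ j < min n₁ n₂, L j = 0 ∨ L j = 1)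
    (μl : Measure (Matrix (Fin l) (Fin l) ℂ)) (hμl : IsHaarUnitary l μl)
    (μm : Measure (Matrix (Fin m) (Fin m) ℂ)) (hμm : IsHaarUnitary m μm) :
    (n₁ ≤ n₂ →
      (∫ k, Phi l (min n₁ n₂) μl s L (g * (k * x * kᴴ) * gᴴ) ∂μm) =
        Csph m (max n₁ n₂) μm (sTilde n₁ n₂ s) * Psi l m n₁ μl s g *
          Phi m n₂ μm (sTilde n₁ n₂ s) (LTilde n₁ n₂ L) x) ∧
    (n₂ ≤ n₁ →
      (∫ k, Phi l (min n₁ n₂) μl s L (g * (k * x * kᴴ) * gᴴ) ∂μm) =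
        Csph m (max n₁ n₂) μm (sTilde n₁ n₂ s) * Psi l m n₁ μl (sTilde n₁ n₂ s) g *
          Phi m n₂ μm s L x) := by
  set r := min n₁ n₂ with hr
  set σ : ℕ → ℂ := fun j => s j - sNext r s j - 1 with hσdef
  set ε : ℕ → ℤ := fun j => L j - LNext r L j - 1 with hεdef
  have hσ : ∀ j < r, 0 ≤ (σ j).re := by
    intro j hj
    have := hs j hj
    simp only [hσdef, Complex.sub_re, Complex.one_re] at this ⊢
    linarith
  have hr1 : r ≤ n₁ := min_le_left _ _
  have hr2 : r ≤ n₂ := min_le_right _ _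
  have hLHS : (∫ k, Phi l r μl s L (g * (k * x * kᴴ) * gᴴ) ∂μm) =
      (∫ h, sP r 0 σ (h * (g * gᴴ) * hᴴ) ∂μl) * (∫ k, sP r ε σ (k * x * kᴴ) ∂μm) /
        (∫ k, sP r 0 σ (k * projMat l r * kᴴ) ∂μl) := by
    unfold Phi
    rw [integral_div, Csph_eq,
      ← main_factor hμl hμm ε σ hσ g x (hr1.trans hn₁l) (hr1.trans hn₁m)]
    rfl
  have Gll := GG_haar (hr1.trans hn₁l) (hr1.trans hn₁l) σ hσ hμl
  have Glm := GG_haar (hr1.trans hn₁m) (hr1.trans hn₁m) σ hσ hμm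
  have Gl1 := GG_haar hn₁l (hr1.trans hn₁l) σ hσ hμl
  have Gm1 := GG_haar hn₁m (hr1.trans hn₁m) σ hσ hμm
  have Gm2 := GG_haar hn₂m (hr1.trans hn₁m) σ hσ hμm
  have Nr := GG_ne_zero r r σ le_rfl hσ
  have N1 := GG_ne_zero r n₁ σ hr1 hσ
  have N2 := GG_ne_zero r n₂ σ hr2 hσ
  rw [hLHS]
  constructor
  · intro h12
    have hr' : r = n₁ := min_eq_left h12
    have hN : n₂ = max n₁ n₂ := (max_eq_right h12).symm
    have hx' := NsphT hμm n₁ n₂ s L hN hx hxr.ge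
    have hC := CsphT hμm n₁ n₂ s hN hn₂m
    have hg' : Nsph l n₁ μl s (Lstd n₁) (g * gᴴ) = ∫ h, sP r 0 σ (h * (g * gᴴ) * hᴴ) ∂μl := by
      rw [← hr']
      exact Nsph_gram (μ := μl) s (Lstd r) g (hr1.trans hn₁l) (hr1.trans hn₁m)
    have hc : Csph l n₁ μl s = ∫ k, sP r 0 σ (k * projMat l r * kᴴ) ∂μl := by
      rw [← hr']
      exact Csph_eq l r μl s
    rw [← hN]
    unfold Psi Phi
    rw [hx', hg', hC, hc]
    rw [Gm2] at N2
    have N2' := right_ne_zero_of_mul N2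
    simp only [← hr, ← hσdef, ← hεdef]
    field_simp
  · intro h21
    have hr' : r = n₂ := min_eq_right h21
    have hN : n₁ = max n₁ n₂ := (max_eq_left h21).symm
    have hx' : Nsph m n₂ μm s L x = ∫ k, sP r ε σ (k * x * kᴴ) ∂μm := by
      rw [← hr']
      rfl
    have hc : Csph m n₂ μm s = ∫ k, sP r 0 σ (k * projMat m r * kᴴ) ∂μm := by
      rw [← hr']
      exact Csph_eq m r μm s
    have hC := CsphT hμm n₁ n₂ s hN hn₁m
    have hC' := CsphT hμl n₁ n₂ s hN hn₁l
    have hg' := NsphT_gram hμl n₁ n₂ s (Lstd n₁) hN g hn₁l hn₁m hg.ge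
    rw [← hN]
    unfold Psi Phi
    rw [hx', hg', hC, hC', hc]
    simp only [← hr, ← hσdef]
    have a1 : (∫ k, sP r 0 σ (k * projMat l r * kᴴ) ∂μl) ≠ 0 := right_ne_zero_of_mul (Gll ▸ Nr)
    have a2 : (∫ k, sP r 0 σ (k * projMat m r * kᴴ) ∂μm) ≠ 0 := right_ne_zero_of_mul (Glm ▸ Nr)
    have a3 : (∫ k, sP r 0 σ (k * projMat l n₁ * kᴴ) ∂μl) ≠ 0 := right_ne_zero_of_mul (Gl1 ▸ N1)
    have a4 : GG r l σ ≠ 0 := left_ne_zero_of_mul (Gl1 ▸ N1)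
    have a5 : GG r m σ ≠ 0 := left_ne_zero_of_mul (Gm1 ▸ N1)
    generalize (∫ k, sP r 0 σ (k * projMat l r * kᴴ) ∂μl) = dlr at *
    generalize (∫ k, sP r 0 σ (k * projMat m r * kᴴ) ∂μm) = dmr at *
    generalize (∫ k, sP r 0 σ (k * projMat l n₁ * kᴴ) ∂μl) = dl1 at *
    generalize (∫ k, sP r 0 σ (k * projMat m n₁ * kᴴ) ∂μm) = dm1 at *
    generalize (∫ h, sP r 0 σ (h * (g * gᴴ) * hᴴ) ∂μl) = A
    generalize (∫ k, sP r ε σ (k * x * kᴴ) ∂μm) = B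
    have key : dl1 * dmr = dm1 * dlr := by
      apply mul_left_cancel₀ (mul_ne_zero a4 a5)
      linear_combination (-GG r m σ * dmr) * Gl1 + (GG r n₁ σ) * (Gll - Glm) + (GG r l σ * dlr) * Gm1
    field_simp
    linear_combination A * B * key

end RMT
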